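/- (Improved bilinear Strichartz estimate I.) Let α ∈ [1,2], 0 < T < 1, and let N₁, N₂ ≥ 1 be dyadic numbers. Let f₁, f₂ ∈ L^∞(]0,T[; L²(T)), let a ∈ L^∞(R²) with ‖a‖_{L^∞} ≤ 1, and let u₁, u₂ ∈ C([0,T]; L²(T)) satisfy ∂_t u_j + L_{α+1}u_j + ∂_x f_j = 0 on ]0,T[ × T in the distributional sense for j = 1, 2. Then there exists a constant C depending only on p_{α+1} (not on T, N₁, N₂, a, u_j, f_j) such that ‖Λ_a(P_{N₁}u₁, P_{N₂}u₂)‖_{L²(]0,T[×T)} ≤ C T^{−1/4} (N₁∨N₂)^{1/2 − α/4} (‖P_{N₁}u₁‖_{L²(]0,T[×T)} + ‖P_{N₁}f₁‖_{L²(]0,T[×T)}) (‖P_{N₂}u₂‖_{L^∞(]0,T[;L²(T))} + ‖P_{N₂}f₂‖_{L^∞(]0,T[;L²(T))}). -/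

import Mathlib

open MeasureTheory Complex Real Set Filter
open scoped ENNReal NNReal

noncomputable section

/-- **Hypothesis 1**: `p` is the symbol of the dispersive operator `L_{α+1}`
(the Fourier multiplier by `-i p(ξ)`); `p` is an odd real-valued function of class `C¹`
on `ℝ` and `C²` away from the origin, and for `ξ ≥ ξ₀` the first and second derivatives
of `p` are comparable to `ξ^α` and `ξ^(α-1)` respectively. -/
structure Hyp1 (α ξ₀ c C : ℝ) (p : ℝ → ℝ) : Prop where
  xi0_pos : 0 < ξ₀
  c_pos : 0 < c
  c_le_C : c ≤ C
  smooth1 : ContDiff ℝ 1 p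
  smooth2 : ∀ x : ℝ, x ≠ 0 → ContDiffAt ℝ 2 p x
  odd : ∀ x : ℝ, p (-x) = -p x
  deriv_lb : ∀ ξ : ℝ, ξ₀ ≤ ξ → c * ξ ^ α ≤ deriv p ξ
  deriv_ub : ∀ ξ : ℝ, ξ₀ ≤ ξ → deriv p ξ ≤ C * ξ ^ α
  deriv2_lb : ∀ ξ : ℝ, ξ₀ ≤ ξ → c * ξ ^ (α - 1) ≤ deriv (deriv p) ξ
  deriv2_ub : ∀ ξ : ℝ, ξ₀ ≤ ξ → deriv (deriv p) ξ ≤ C * ξ ^ (α - 1)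

/-- The fixed smooth even cutoff function `χ`: `0 ≤ χ ≤ 1`, `χ ≡ 1` on `[-1,1]`,
`supp χ ⊆ [-2,2]`. -/
structure CutoffFun (χ : ℝ → ℝ) : Prop where
  smooth : ContDiff ℝ (⊤ : ℕ∞) χ
  even : ∀ x : ℝ, χ (-x) = χ x
  nonneg : ∀ x : ℝ, 0 ≤ χ x
  le_one : ∀ x : ℝ, χ x ≤ 1
  eq_one : ∀ x ∈ Set.Icc (-1 : ℝ) 1, χ x = 1
  compact_supp : ∀ x : ℝ, χ x ≠ 0 → x ∈ Set.Icc (-2 : ℝ) 2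

/-- The Littlewood–Paley symbol `φ_N`: for a dyadic `N ≥ 1`, `φ_N(ξ) = χ(ξ/N) - χ(2ξ/N)`,
and `φ_0(ξ) = χ(2ξ)`. -/
def lpSymb (χ : ℝ → ℝ) (N ξ : ℝ) : ℝ :=
  if N = 0 then χ (2 * ξ) else χ (ξ / N) - χ (2 * ξ / N)

/-- The Littlewood–Paley projector `P_N`, acting on the (spatial) Fourier coefficients
of a function on the torus. -/
def PN (χ : ℝ → ℝ) (N : ℝ) (u : ℤ → ℂ) : ℤ → ℂ := fun ξ => (lpSymb χ N ξ : ℂ) * u ξ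

/-- Square of the `L²(𝕋)` norm, computed on Fourier coefficients (Parseval). -/
def l2sq (v : ℤ → ℂ) : ℝ := ∑' ξ : ℤ, ‖v ξ‖ ^ 2

/-- `L²(S × 𝕋)` norm of a space-time function given by its spatial Fourier
coefficients `U t ξ`, `S ⊆ ℝ` a set of times. -/
def L2normOn (S : Set ℝ) (U : ℝ → ℤ → ℂ) : ℝ := (∫ t in S, l2sq (U t)) ^ ((1:ℝ)/2)

/-- `L²(ℝ × 𝕋)` norm. -/
def L2full (U : ℝ → ℤ → ℂ) : ℝ := (∫ t : ℝ, l2sq (U t)) ^ ((1:ℝ)/2)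

/-- `L^∞(]0,T[; L²(𝕋))` norm. -/
def LinfL2 (T : ℝ) (U : ℝ → ℤ → ℂ) : ℝ := ⨆ t : Set.Ioo (0:ℝ) T, (l2sq (U t)) ^ ((1:ℝ)/2)

/-- Membership in `L²(ℝ × 𝕋)`. -/
def MemL2 (U : ℝ → ℤ → ℂ) : Prop :=
  (∀ t : ℝ, Summable fun ξ : ℤ => ‖U t ξ‖ ^ 2) ∧
  (∀ ξ : ℤ, Measurable fun t : ℝ => U t ξ) ∧
  Integrable (fun t : ℝ => l2sq (U t))

/-- Membership in `L^∞(]0,T[; L²(𝕋))`, together with measurability of the coefficients. -/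
def MemLinfL2 (T : ℝ) (U : ℝ → ℤ → ℂ) : Prop :=
  (∀ t ∈ Set.Ioo (0:ℝ) T, Summable fun ξ : ℤ => ‖U t ξ‖ ^ 2) ∧
  (∀ ξ : ℤ, Measurable fun t : ℝ => U t ξ) ∧
  (∃ M : ℝ, ∀ t ∈ Set.Ioo (0:ℝ) T, l2sq (U t) ≤ M)

/-- Continuity with values in `L²(𝕋)` on `[0,T]`. -/
def ContL2On (T : ℝ) (U : ℝ → ℤ → ℂ) : Prop :=
  ∀ t₀ ∈ Set.Icc (0:ℝ) T,
    Filter.Tendsto (fun t => l2sq (fun ξ => U t ξ - U t₀ ξ))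
      (nhdsWithin t₀ (Set.Icc (0:ℝ) T)) (nhds 0)

/-- Time Fourier transform (with the convention `∫ e^{-iτt} g(t) dt`). -/
def FT (g : ℝ → ℂ) (τ : ℝ) : ℂ := ∫ t : ℝ, Complex.exp (-(Complex.I * τ * t)) * g t

/-- Inverse time Fourier transform. -/
def IFT (g : ℝ → ℂ) (t : ℝ) : ℂ :=
  (2 * Real.pi)⁻¹ • ∫ τ : ℝ, Complex.exp (Complex.I * τ * t) * g τ

/-- The modulation projector `Q_L`, a space-time Fourier multiplier with symbol
`ψ_L(τ,ξ) = φ_L(τ - p(ξ))` (acting on spatial Fourier coefficients `U t ξ`). -/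
def QL (χ p : ℝ → ℝ) (L : ℝ) (U : ℝ → ℤ → ℂ) : ℝ → ℤ → ℂ := fun t ξ =>
  IFT (fun τ => (lpSymb χ L (τ - p ξ) : ℂ) * FT (fun s => U s ξ) τ) t

/-- `Q_{≤ 2^l} = Q_0 + ∑_{j ≤ l} Q_{2^j}`. -/
def Qle (χ p : ℝ → ℝ) (l : ℕ) (U : ℝ → ℤ → ℂ) : ℝ → ℤ → ℂ := fun t ξ =>
  QL χ p 0 U t ξ + ∑ j ∈ Finset.range (l + 1), QL χ p ((2:ℝ) ^ j) U t ξ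

/-- The `X^{0,1/2,1}` (Besov–Bourgain) norm:
`‖u‖ = ∑_L max(L,1)^{1/2} ‖Q_L u‖_{L²(ℝ×𝕋)}`, `L` running over `{0} ∪ 2^ℕ`. -/
def Xhalf (χ p : ℝ → ℝ) (U : ℝ → ℤ → ℂ) : ℝ :=
  L2full (QL χ p 0 U) + ∑' l : ℕ, ((2:ℝ) ^ l) ^ ((1:ℝ)/2) * L2full (QL χ p ((2:ℝ) ^ l) U)

/-- Membership in `X^{0,1/2,1}`. -/
def MemX (χ p : ℝ → ℝ) (U : ℝ → ℤ → ℂ) : Prop :=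
  (∀ ξ : ℤ, Measurable fun t : ℝ => U t ξ) ∧
  Integrable (fun t : ℝ => l2sq (QL χ p 0 U t)) ∧
  (∀ l : ℕ, Integrable fun t : ℝ => l2sq (QL χ p ((2:ℝ) ^ l) U t)) ∧
  Summable (fun l : ℕ => ((2:ℝ) ^ l) ^ ((1:ℝ)/2) * L2full (QL χ p ((2:ℝ) ^ l) U))

/-- The bilinear operator `Λ_a`:
`(Λ_a(u,v))^(ξ) = ∑_{ξ₁+ξ₂=ξ} a(ξ₁,ξ₂) û(ξ₁) v̂(ξ₂)`. -/
def Lam (a : ℝ → ℝ → ℂ) (u v : ℤ → ℂ) : ℤ → ℂ := fun ξ =>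
  ∑' ξ₁ : ℤ, a ξ₁ ((ξ : ℝ) - ξ₁) * u ξ₁ * v (ξ - ξ₁)

/-- `u` solves `∂_t u + L_{α+1} u + ∂_x f = 0` on `]0,T[ × 𝕋` (in the distributional
sense), formulated equivalently through the Duhamel formula on each spatial Fourier
mode; `U` and `F` are the spatial Fourier coefficients of `u` and `f`. -/
def Solves (p : ℝ → ℝ) (T : ℝ) (U F : ℝ → ℤ → ℂ) : Prop :=
  ∀ ξ : ℤ, ∀ t ∈ Set.Icc (0:ℝ) T,
    U t ξ = Complex.exp (Complex.I * (p ξ) * t) * U 0 ξ -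
      ∫ s in (0:ℝ)..t,
        Complex.exp (Complex.I * (p ξ) * (t - s)) * (Complex.I * (ξ:ℂ)) * F s ξ

/-- Fourier coefficients of the free evolution `e^{-tL_{α+1}} φ`. -/
def freeEvol (p : ℝ → ℝ) (φ : ℤ → ℂ) : ℝ → ℤ → ℂ := fun t ξ =>
  Complex.exp (Complex.I * (p ξ) * t) * φ ξ


lemma bs_nat_sum (ε : ℝ) (hε : 0 < ε) (A : Finset ℕ) :
    ∑ m ∈ A, 1 / (1 + (ε * (m + 1)) ^ 2) ≤ 2 / ε := by
  obtain ⟨n, hn⟩ := A.exists_nat_subset_range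
  have h1 : ∑ m ∈ A, 1 / (1 + (ε * ((m:ℝ) + 1)) ^ 2) ≤
      ∑ m ∈ Finset.range n, 1 / (1 + (ε * ((m:ℝ) + 1)) ^ 2) :=
    Finset.sum_le_sum_of_subset_of_nonneg hn (fun _ _ _ => by positivity)
  have h2 : ∀ n : ℕ, ∑ m ∈ Finset.range n, 1 / (1 + (ε * ((m:ℝ) + 1)) ^ 2) ≤
      2 / ε * (1 - 1 / (1 + ε * n)) := by
    intro n
    induction n with
    | zero => simp
    | succ n ih =>
      rw [Finset.sum_range_succ]
      have : 1 / (1 + (ε * ((n:ℝ) + 1)) ^ 2) ≤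
        2 / ε * (1 / (1 + ε * n) - 1 / (1 + ε * ((n:ℝ)+1))) := by
        have hpos : 0 < 1 + ε * n := by positivity
        have hpos2 : 0 < 1 + ε * ((n:ℝ)+1) := by positivity
        have : 2 / ε * (1 / (1 + ε * n) - 1 / (1 + ε * ((n:ℝ)+1))) =
          2 / ((1 + ε * n) * (1 + ε * ((n:ℝ)+1))) := by
          field_simp; ring
        rw [this, div_le_div_iff₀ (by positivity) (by positivity)]
        nlinarith [sq_nonneg (1 - ε * ((n:ℝ)+1)), mul_pos hε hpos2]
      push_cast
      calc _ ≤ _ := add_le_add ih this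
        _ = _ := by ring
  refine h1.trans ((h2 n).trans ?_)
  have : 0 ≤ 1 / (1 + ε * (n:ℝ)) := by positivity
  have h3 : 0 ≤ 2 / ε := by positivity
  nlinarith

lemma bs_int_sum (ε : ℝ) (hε : 0 < ε) (S : Finset ℤ) (k : ℤ) :
    ∑ l ∈ S, 1 / (1 + (ε * ((k:ℝ) - l)) ^ 2) ≤ 1 + 4 / ε := by
  classical
  have key : ∀ P : ℤ → Prop, ∀ [DecidablePred P], (∀ l, P l → l ≠ k) →
      (∀ l l', P l → P l' → (l - k).natAbs = (l' - k).natAbs → l = l') →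
      ∑ l ∈ S.filter P, 1 / (1 + (ε * ((k:ℝ) - l)) ^ 2) ≤ 2 / ε := by
    intro P _ h1 h2
    have := bs_nat_sum ε hε ((S.filter P).image (fun l => (l - k).natAbs - 1))
    rw [Finset.sum_image] at this
    · refine le_trans (le_of_eq ?_) this
      refine Finset.sum_congr rfl fun l hl => ?_
      have hne := h1 l (Finset.mem_filter.1 hl).2
      have h3 : 1 ≤ (l - k).natAbs := by omega
      have : ((((l - k).natAbs - 1 : ℕ) : ℝ) + 1) = |(l:ℝ) - k| := by
        rw [Nat.cast_sub h3]
        have : (((l-k).natAbs : ℕ) : ℝ) = |(l:ℝ) - k| := by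
          rw [Nat.cast_natAbs]; push_cast; rfl
        rw [this]; simp
      rw [this, mul_pow, mul_pow, sq_abs]
      ring
    · intro l hl l' hl' h
      simp only [Finset.coe_filter, Set.mem_setOf_eq] at hl hl'
      have a1 := h1 l hl.2
      have a2 := h1 l' hl'.2
      apply h2 l l' hl.2 hl'.2
      simp only at h
      omega
  have e1 := key (fun l => k < l) (by intro l; omega) (by intro l l'; omega)
  have e2 := key (fun l => l < k) (by intro l; omega) (by intro l l'; omega)
  have e3 : ∑ l ∈ S.filter (fun l => l = k), 1 / (1 + (ε * ((k:ℝ) - l)) ^ 2) ≤ 1 := by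
    rw [Finset.sum_filter]
    rw [Finset.sum_ite_eq']
    split_ifs <;> simp
  have : ∑ l ∈ S, 1 / (1 + (ε * ((k:ℝ) - l)) ^ 2) =
     ∑ l ∈ S.filter (fun l => l = k), 1 / (1 + (ε * ((k:ℝ) - l)) ^ 2) +
     (∑ l ∈ S.filter (fun l => k < l), 1 / (1 + (ε * ((k:ℝ) - l)) ^ 2) +
     ∑ l ∈ S.filter (fun l => l < k), 1 / (1 + (ε * ((k:ℝ) - l)) ^ 2)) := by
    simp only [Finset.sum_filter, ← Finset.sum_add_distrib]
    refine Finset.sum_congr rfl fun l _ => ?_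
    rcases lt_trichotomy l k with h | h | h
    · simp [h, h.ne, h.not_gt]
    · simp [h]
    · simp [h, h.ne', h.not_gt]
  rw [this]
  have : 4 / ε = 2 / ε + 2 / ε := by ring
  linarith

lemma bs_gauss_int (δ : ℝ) (hδ : 0 < δ) (μ : ℝ) :
    Integrable (fun t : ℝ => cexp (-(1 / δ ^ 2 : ℝ) * t ^ 2 + (I * μ) * t)) ∧
    ∫ t : ℝ, cexp (-(1 / δ ^ 2 : ℝ) * t ^ 2 + (I * μ) * t) =
      ((√π * δ * Real.exp (-(μ * δ) ^ 2 / 4) : ℝ) : ℂ) := by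
  have hb : 0 < (((1 / δ ^ 2 : ℝ) : ℂ)).re := by rw [ofReal_re]; positivity
  constructor
  · have := GaussianFourier.integrable_cexp_neg_mul_sq_add_real_mul_I (b := ((1/δ^2:ℝ):ℂ)) hb 0
    have h2 := integrable_cexp_quadratic' (b := -((1/δ^2:ℝ):ℂ)) (by simpa using hb) (I * μ) 0
    simpa using h2
  · have := integral_cexp_quadratic (b := -((1/δ^2:ℝ):ℂ)) (by simpa using hb) (I * μ) 0
    simp only [add_zero, neg_neg] at this
    rw [this]
    have h1 : ((π:ℂ) / ((1 / δ ^ 2 : ℝ) : ℂ)) ^ (1 / 2 : ℂ) = ((√π * δ : ℝ) : ℂ) := by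
      rw [← ofReal_div]
      have : (1/2 : ℂ) = ((1/2 : ℝ) : ℂ) := by push_cast; rfl
      rw [this, ← ofReal_cpow (by positivity), ← Real.sqrt_eq_rpow]
      congr 1
      rw [div_div_eq_mul_div, div_one, Real.sqrt_mul pi_pos.le, Real.sqrt_sq hδ.le]
    rw [h1]
    have h2 : (0 - (I * (μ:ℂ)) ^ 2 / (4 * -(((1/δ^2:ℝ)):ℂ))) = ((-(μ * δ) ^ 2 / 4 : ℝ) : ℂ) := by
      rw [mul_pow, I_sq]
      have : (δ:ℂ) ≠ 0 := by exact_mod_cast hδ.ne'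
      push_cast
      field_simp
      ring
    rw [h2, ← ofReal_exp]
    push_cast; ring

lemma bs_gauss_expand (δ : ℝ) (hδ : 0 < δ) (S : Finset ℤ) (lam : ℤ → ℝ) (b : ℤ → ℂ) :
    Integrable (fun t : ℝ => Real.exp (-t ^ 2 / δ ^ 2) *
      ‖∑ k ∈ S, b k * cexp (I * lam k * t)‖ ^ 2) ∧
    ((∫ t : ℝ, Real.exp (-t ^ 2 / δ ^ 2) * ‖∑ k ∈ S, b k * cexp (I * lam k * t)‖ ^ 2 : ℝ) : ℂ) =
     ∑ k ∈ S, ∑ l ∈ S, b k * (starRingEnd ℂ) (b l) *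
       ((√π * δ * Real.exp (-((lam k - lam l) * δ) ^ 2 / 4) : ℝ) : ℂ) := by
  have hpt : ∀ t : ℝ, ((Real.exp (-t ^ 2 / δ ^ 2) *
      ‖∑ k ∈ S, b k * cexp (I * lam k * t)‖ ^ 2 : ℝ) : ℂ) =
      ∑ k ∈ S, ∑ l ∈ S, b k * (starRingEnd ℂ) (b l) *
        cexp (-(1 / δ ^ 2 : ℝ) * t ^ 2 + (I * (lam k - lam l : ℝ)) * t) := by
    intro t
    rw [ofReal_mul, ofReal_pow, ← Complex.mul_conj', map_sum, Finset.sum_mul_sum, Finset.mul_sum]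
    refine Finset.sum_congr rfl fun k _ => ?_
    rw [Finset.mul_sum]
    refine Finset.sum_congr rfl fun l _ => ?_
    rw [map_mul, ← Complex.exp_conj, ofReal_exp]
    simp only [map_mul, conj_I, conj_ofReal]
    have : -((1 / δ ^ 2 : ℝ):ℂ) * (t:ℂ) ^ 2 + (I * (lam k - lam l : ℝ)) * t =
      ((-t ^ 2 / δ ^ 2 : ℝ) : ℂ) + (I * lam k * t) + (-I * lam l * t) := by
      push_cast; ring
    rw [this, Complex.exp_add, Complex.exp_add]
    ring
  have hIntg : Integrable (fun t : ℝ => ∑ k ∈ S, ∑ l ∈ S, b k * (starRingEnd ℂ) (b l) *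
        cexp (-(1 / δ ^ 2 : ℝ) * t ^ 2 + (I * (lam k - lam l : ℝ)) * t)) :=
    integrable_finsetSum _ fun k _ => integrable_finsetSum _ fun l _ =>
      (bs_gauss_int δ hδ _).1.const_mul _
  constructor
  · have := hIntg.re
    refine this.congr (Eventually.of_forall fun t => ?_)
    simp only
    rw [← hpt t]
    exact ofReal_re _
  · refine (integral_ofReal (𝕜 := ℂ)).symm.trans ?_
    have : (fun t : ℝ => ((Real.exp (-t ^ 2 / δ ^ 2) *
      ‖∑ k ∈ S, b k * cexp (I * lam k * t)‖ ^ 2 : ℝ) : ℂ)) = _ := funext hpt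
    refine (congrArg (fun f : ℝ → ℂ => ∫ t, f t) this).trans ?_
    rw [integral_finsetSum _ fun k _ => integrable_finsetSum _ fun l _ =>
      (bs_gauss_int δ hδ _).1.const_mul _]
    refine Finset.sum_congr rfl fun k _ => ?_
    rw [integral_finsetSum _ fun l _ => (bs_gauss_int δ hδ _).1.const_mul _]
    refine Finset.sum_congr rfl fun l _ => ?_
    rw [integral_const_mul, (bs_gauss_int δ hδ _).2]

lemma bs_sieve0 (δ d : ℝ) (hδ : 0 < δ) (hd : 0 < d) (S : Finset ℤ) (lam : ℤ → ℝ) (b : ℤ → ℂ)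
    (hsep : ∀ k ∈ S, ∀ l ∈ S, d * |(k:ℝ) - l| ≤ |lam k - lam l|) :
    ∫ t in (0:ℝ)..δ, ‖∑ k ∈ S, b k * cexp (I * lam k * t)‖ ^ 2 ≤
      Real.exp 1 * (√π * δ * ((1 + 8 / (d * δ)) * ∑ k ∈ S, ‖b k‖ ^ 2)) := by
  obtain ⟨hi, he⟩ := bs_gauss_expand δ hδ S lam b
  set J := ∫ t : ℝ, Real.exp (-t ^ 2 / δ ^ 2) * ‖∑ k ∈ S, b k * cexp (I * lam k * t)‖ ^ 2 with hJ
  have h1 : ∫ t in (0:ℝ)..δ, ‖∑ k ∈ S, b k * cexp (I * lam k * t)‖ ^ 2 ≤ Real.exp 1 * J := by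
    rw [intervalIntegral.integral_of_le hδ.le, hJ, ← integral_const_mul]
    refine le_trans (setIntegral_mono_on (g := fun t : ℝ => Real.exp 1 *
       (Real.exp (-t ^ 2 / δ ^ 2) * ‖∑ k ∈ S, b k * cexp (I * lam k * t)‖ ^ 2)) ?_
       (hi.const_mul _).integrableOn measurableSet_Ioc ?_) 
       (setIntegral_le_integral (hi.const_mul _) (Eventually.of_forall fun t => ?_))
    · exact (Continuous.integrableOn_Ioc (by fun_prop))
    · intro t ht
      rw [← mul_assoc, ← Real.exp_add]
      have : 0 ≤ 1 + -t ^ 2 / δ ^ 2 := by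
        have : t ^ 2 / δ ^ 2 ≤ 1 := by
          rw [div_le_one (by positivity)]
          exact pow_le_pow_left₀ ht.1.le ht.2 2
        rw [neg_div]; linarith
      exact le_mul_of_one_le_left (by positivity) (Real.one_le_exp this)
    · simp only [Pi.zero_apply]; positivity
  refine h1.trans (mul_le_mul_of_nonneg_left ?_ (Real.exp_pos 1).le)
  set E : ℤ → ℤ → ℝ := fun k l => Real.exp (-((lam k - lam l) * δ) ^ 2 / 4) with hE
  have hEs : ∀ k l, E k l = E l k := by
    intro k l; simp only [hE]; congr 1; ring
  have hE0 : ∀ k l, 0 ≤ E k l := fun k l => (Real.exp_pos _).le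
  have hES : ∀ k ∈ S, ∑ l ∈ S, E k l ≤ 1 + 8 / (d * δ) := by
    intro k hk
    have := bs_int_sum (d * δ / 2) (by positivity) S k
    have e : 4 / (d * δ / 2) = 8 / (d * δ) := by field_simp; norm_num
    rw [e] at this
    refine le_trans (Finset.sum_le_sum fun l hl => ?_) this
    have h2 := hsep k hk l hl
    have h3 : (d * δ / 2 * ((k:ℝ) - l)) ^ 2 ≤ ((lam k - lam l) * δ) ^ 2 / 4 := by
      have : (d * |(k:ℝ) - l|) ^ 2 ≤ |lam k - lam l| ^ 2 := pow_le_pow_left₀ (by positivity) h2 2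
      rw [mul_pow, sq_abs, sq_abs] at this
      nlinarith [sq_nonneg δ]
    simp only [hE]
    rw [neg_div, Real.exp_neg, ← one_div]
    apply one_div_le_one_div_of_le (by positivity)
    have := Real.add_one_le_exp (((lam k - lam l) * δ) ^ 2 / 4)
    linarith
  have h4 : J ≤ ∑ k ∈ S, ∑ l ∈ S, ‖b k‖ * ‖b l‖ * (√π * δ * E k l) := by
    calc J ≤ ‖(J:ℂ)‖ := by rw [Complex.norm_real]; exact le_abs_self _
      _ ≤ _ := by
        rw [he]
        refine (norm_sum_le _ _).trans (Finset.sum_le_sum fun k _ => ?_)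
        refine (norm_sum_le _ _).trans (Finset.sum_le_sum fun l _ => ?_)
        rw [norm_mul, norm_mul, RCLike.norm_conj, Complex.norm_real, Real.norm_eq_abs,
          abs_of_nonneg (by positivity)]
  refine h4.trans ?_
  have h5 : ∑ k ∈ S, ∑ l ∈ S, ‖b k‖ * ‖b l‖ * (√π * δ * E k l) ≤
     ∑ k ∈ S, ∑ l ∈ S, (√π * δ) * ((‖b k‖ ^ 2 * E k l + ‖b l‖ ^ 2 * E l k) / 2) := by
    refine Finset.sum_le_sum fun k _ => Finset.sum_le_sum fun l _ => ?_
    rw [hEs l k]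
    have : 0 ≤ √π * δ * E k l := by have := hE0 k l; positivity
    nlinarith [sq_nonneg (‖b k‖ - ‖b l‖)]
  refine h5.trans ?_
  have h6 : ∑ k ∈ S, ∑ l ∈ S, (√π * δ) * ((‖b k‖ ^ 2 * E k l + ‖b l‖ ^ 2 * E l k) / 2) =
     (√π * δ) * ∑ k ∈ S, ‖b k‖ ^ 2 * ∑ l ∈ S, E k l := by
    simp only [← Finset.mul_sum, ← Finset.sum_div, Finset.sum_add_distrib]
    rw [Finset.sum_comm (f := fun k l => ‖b l‖ ^ 2 * E l k)]
    simp only [← Finset.mul_sum]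
    ring
  rw [h6]
  refine mul_le_mul_of_nonneg_left ?_ (by positivity)
  rw [Finset.mul_sum]
  refine Finset.sum_le_sum fun k hk => ?_
  rw [mul_comm]
  exact mul_le_mul_of_nonneg_right (hES k hk) (by positivity)

lemma bs_sieve (t₀ δ d : ℝ) (hδ : 0 < δ) (hd : 0 < d) (S : Finset ℤ) (lam : ℤ → ℝ) (b : ℤ → ℂ)
    (hsep : ∀ k ∈ S, ∀ l ∈ S, d * |(k:ℝ) - l| ≤ |lam k - lam l|) :
    ∫ t in t₀..(t₀ + δ), ‖∑ k ∈ S, b k * cexp (I * lam k * t)‖ ^ 2 ≤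
      8 * δ * (1 + 8 / (d * δ)) * ∑ k ∈ S, ‖b k‖ ^ 2 := by
  have h := bs_sieve0 δ d hδ hd S lam (fun k => b k * cexp (I * lam k * t₀)) hsep
  have e1 : ∀ k, ‖b k * cexp (I * lam k * t₀)‖ = ‖b k‖ := by
    intro k
    rw [norm_mul, show I * lam k * t₀ = ((lam k * t₀ : ℝ) : ℂ) * I by push_cast; ring,
      Complex.norm_exp_ofReal_mul_I, mul_one]
  simp only [e1] at h
  have e2 : ∫ t in (0:ℝ)..δ, ‖∑ k ∈ S, b k * cexp (I * lam k * t₀) * cexp (I * lam k * t)‖ ^ 2 =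
      ∫ t in t₀..(t₀ + δ), ‖∑ k ∈ S, b k * cexp (I * lam k * t)‖ ^ 2 := by
    have := intervalIntegral.integral_comp_add_left
      (f := fun t : ℝ => ‖∑ k ∈ S, b k * cexp (I * lam k * t)‖ ^ 2) (a := 0) (b := δ) t₀
    rw [add_zero] at this
    rw [← this]
    refine intervalIntegral.integral_congr fun t _ => ?_
    congr 2
    refine Finset.sum_congr rfl fun k _ => ?_
    rw [mul_assoc, ← Complex.exp_add]
    congr 2
    push_cast; ring
  rw [e2] at h
  refine h.trans ?_
  have h7 : Real.exp 1 * √π ≤ 8 := by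
    have h1 := Real.exp_one_lt_d9
    have h2 : √π ≤ 2 := by
      rw [Real.sqrt_le_left (by norm_num)]; linarith [Real.pi_lt_d2]
    nlinarith [Real.sqrt_nonneg π, Real.exp_pos 1]
  have h8 : 0 ≤ δ * ((1 + 8 / (d * δ)) * ∑ k ∈ S, ‖b k‖ ^ 2) := by positivity
  calc _ = (Real.exp 1 * √π) * (δ * ((1 + 8 / (d * δ)) * ∑ k ∈ S, ‖b k‖ ^ 2)) := by ring
    _ ≤ 8 * (δ * ((1 + 8 / (d * δ)) * ∑ k ∈ S, ‖b k‖ ^ 2)) := by gcongr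
    _ = _ := by ring

lemma bs_deriv_even {p : ℝ → ℝ} (hodd : ∀ x : ℝ, p (-x) = -p x) (x : ℝ) :
    deriv p (-x) = deriv p x := by
  have h1 : deriv (fun x => p (-x)) x = -deriv p (-x) := deriv_comp_neg p x
  have h2 : (fun x => p (-x)) = fun x => -p x := funext hodd
  rw [h2, deriv.fun_neg] at h1
  linarith

lemma bs_deriv_gap {α ξ₀ c₀ C₀ : ℝ} (hα : α ∈ Set.Icc (1:ℝ) 2)
    {p : ℝ → ℝ} (hp : Hyp1 α ξ₀ c₀ C₀ p) :
    ∃ X₀ : ℝ, 1 ≤ X₀ ∧ ∀ x y : ℝ, X₀ ≤ x → 0 ≤ y → y ≤ x →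
      c₀ / 2 * x ^ (α - 1) * (x - y) ≤ deriv p x - deriv p y := by
  obtain ⟨hα1, hα2⟩ := hα
  have hc := hp.c_pos
  have hcont : Continuous (deriv p) := hp.smooth1.continuous_deriv (by norm_num)
  obtain ⟨B, hB⟩ := (isCompact_Icc (a := (0:ℝ)) (b := ξ₀)).bddAbove_image hcont.continuousOn
  have hB' : ∀ y, 0 ≤ y → y ≤ ξ₀ → deriv p y ≤ B := fun y h1 h2 =>
    hB (Set.mem_image_of_mem _ ⟨h1, h2⟩)
  refine ⟨max (max 1 ξ₀) (2 * B / c₀), le_trans (le_max_left _ _) (le_max_left _ _), ?_⟩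
  intro x y hx hy hyx
  have hx1 : 1 ≤ x := (le_trans (le_max_left _ _) (le_max_left _ _)).trans hx
  have hx2 : ξ₀ ≤ x := (le_trans (le_max_right _ _) (le_max_left _ _)).trans hx
  have hx3 : 2 * B / c₀ ≤ x := (le_max_right _ _).trans hx
  have hx0 : 0 < x := by linarith
  have hxa : x ^ α = x ^ (α - 1) * x := by
    rw [← Real.rpow_add_one hx0.ne']; congr 1; ring
  have hpos : 0 < x ^ (α - 1) := Real.rpow_pos_of_pos hx0 _
  rcases le_total ξ₀ y with h | h
  · -- monotonicity of the derivative minus c/α s^α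
    have hder : ∀ s, ξ₀ < s → HasDerivAt (fun s => deriv p s - c₀ / α * s ^ α)
        (deriv (deriv p) s - c₀ / α * (α * s ^ (α - 1))) s := by
      intro s hs
      have hs0 : 0 < s := hp.xi0_pos.trans hs
      have hd : DifferentiableAt ℝ (deriv p) s := by
        apply differentiableAt_of_deriv_ne_zero
        have := hp.deriv2_lb s hs.le
        have h2 : 0 < c₀ * s ^ (α - 1) := mul_pos hc (Real.rpow_pos_of_pos hs0 _)
        linarith
      exact hd.hasDerivAt.sub ((Real.hasDerivAt_rpow_const (Or.inl hs0.ne')).const_mul _)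
    have hmono : MonotoneOn (fun s => deriv p s - c₀ / α * s ^ α) (Set.Ici ξ₀) := by
      apply monotoneOn_of_deriv_nonneg (convex_Ici _)
      · refine hcont.continuousOn.sub (ContinuousOn.mul continuousOn_const ?_)
        exact fun s hs => (Real.continuousAt_rpow_const _ _ (Or.inr (by linarith))).continuousWithinAt
      · intro s hs
        rw [interior_Ici] at hs
        exact (hder s hs).differentiableAt.differentiableWithinAt
      · intro s hs
        rw [interior_Ici] at hs
        rw [(hder s hs).deriv]
        have := hp.deriv2_lb s (le_of_lt hs)
        have e : c₀ / α * (α * s ^ (α - 1)) = c₀ * s ^ (α - 1) := by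
          field_simp
        rw [e]; linarith
    have h1 := hmono h (h.trans hyx) hyx
    simp only at h1
    have h2 : y ^ α ≤ x ^ (α - 1) * y := by
      have hy0 : 0 < y := hp.xi0_pos.trans_le h
      have : y ^ α = y ^ (α - 1) * y := by
        rw [← Real.rpow_add_one hy0.ne']; congr 1; ring
      rw [this]
      gcongr
    have h3 : c₀ / 2 ≤ c₀ / α := div_le_div_of_nonneg_left hc.le (by linarith) hα2
    have h4 : 0 ≤ x ^ (α - 1) * (x - y) := mul_nonneg hpos.le (by linarith)
    calc c₀ / 2 * x ^ (α - 1) * (x - y) = c₀ / 2 * (x ^ (α - 1) * (x - y)) := by ring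
      _ ≤ c₀ / α * (x ^ (α - 1) * (x - y)) := by gcongr
      _ ≤ c₀ / α * (x ^ α - y ^ α) := by
        gcongr
        rw [hxa]; linarith
      _ ≤ _ := by linarith
  · have h1 := hp.deriv_lb x hx2
    have h2 := hB' y hy h
    have h3 : B ≤ c₀ / 2 * x ^ α := by
      rw [div_le_iff₀ hc] at hx3
      have : x ≤ x ^ α := by
        calc x = x ^ (1:ℝ) := (Real.rpow_one x).symm
          _ ≤ _ := Real.rpow_le_rpow_of_exponent_le hx1 hα1
      nlinarith
    have h4 : c₀ / 2 * x ^ (α - 1) * (x - y) ≤ c₀ / 2 * x ^ (α - 1) * x := by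
      gcongr; linarith
    have h5 : c₀ / 2 * x ^ (α - 1) * x = c₀ / 2 * x ^ α := by rw [hxa]; ring
    linarith

lemma bs_phase0 {α c₀ X₀ : ℝ} (hα : α ∈ Set.Icc (1:ℝ) 2) (hc : 0 < c₀) (hX : 1 ≤ X₀)
    {p : ℝ → ℝ} (hd : Differentiable ℝ p) (hodd : ∀ x : ℝ, p (-x) = -p x)
    (hgap : ∀ x y : ℝ, X₀ ≤ x → 0 ≤ y → y ≤ x →
      c₀ / 2 * x ^ (α - 1) * (x - y) ≤ deriv p x - deriv p y)
    {N K ξ : ℝ} (hN : 2 * X₀ ≤ N) (hK : 0 < K) (hξ : K ≤ ξ) {x₁ x₂ : ℝ}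
    (h1 : N / 2 ≤ x₁) (h1' : K ≤ 2 * x₁ - ξ) (h12 : x₁ ≤ x₂) :
    c₀ / 4 * N ^ (α - 1) * K * (x₂ - x₁) ≤
      (p x₂ + p (ξ - x₂)) - (p x₁ + p (ξ - x₁)) := by
  have hder : ∀ x, HasDerivAt (fun x => p x + p (ξ - x)) (deriv p x - deriv p (ξ - x)) x := by
    intro x
    have e1 := (hd x).hasDerivAt
    have e2 : HasDerivAt (fun x => ξ - x) (-1) x := by
      simpa using (hasDerivAt_id x).const_sub ξ
    have e3 := (hd (ξ - x)).hasDerivAt.comp x e2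
    convert! e1.add e3 using 1
    ring
  have := Convex.mul_sub_le_image_sub_of_le_deriv (convex_Ici x₁)
    (f := fun x => p x + p (ξ - x)) (C := c₀ / 4 * N ^ (α - 1) * K)
    (fun x _ => (hder x).continuousAt.continuousWithinAt)
    (fun x _ => (hder x).differentiableAt.differentiableWithinAt) ?_ x₁ (Set.mem_Ici.2 le_rfl) x₂
    (Set.mem_Ici.2 h12) h12
  · exact this
  · intro x hx
    rw [interior_Ici] at hx
    rw [(hder x).deriv]
    have hx' : x₁ < x := hx
    have e1 : deriv p (ξ - x) = deriv p |ξ - x| := by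
      rcases abs_choice (ξ - x) with h | h
      · rw [h]
      · rw [h, bs_deriv_even hodd]
    have hle : |ξ - x| ≤ x - K := abs_le.2 ⟨by linarith, by linarith⟩
    have hg := hgap x |ξ - x| (by linarith) (abs_nonneg _) (by linarith)
    rw [e1]
    refine le_trans ?_ hg
    have e2 : 1 / 2 * N ^ (α - 1) ≤ x ^ (α - 1) := by
      have hN0 : 0 < N := by linarith
      have : (N / 2) ^ (α - 1) ≤ x ^ (α - 1) :=
        Real.rpow_le_rpow (by positivity) (by linarith) (by linarith [hα.1])
      refine le_trans ?_ this
      rw [Real.div_rpow hN0.le (by norm_num)]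
      have h2 : (2:ℝ) ^ (α - 1) ≤ 2 := by
        calc (2:ℝ) ^ (α - 1) ≤ 2 ^ (1:ℝ) :=
              Real.rpow_le_rpow_of_exponent_le (by norm_num) (by linarith [hα.2])
          _ = 2 := by norm_num
      have h3 : 0 < N ^ (α - 1) := Real.rpow_pos_of_pos hN0 _
      have h4 : (0:ℝ) < 2 ^ (α - 1) := by positivity
      rw [le_div_iff₀ h4]
      nlinarith
    have hN0 : 0 < N := by linarith
    have h3 : 0 < N ^ (α - 1) := Real.rpow_pos_of_pos hN0 _
    calc c₀ / 4 * N ^ (α - 1) * K = c₀ / 2 * (1 / 2 * N ^ (α - 1)) * K := by ring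
      _ ≤ c₀ / 2 * x ^ (α - 1) * (x - |ξ - x|) := by
        have h4 : 0 < x ^ (α - 1) := by linarith
        gcongr
        linarith

lemma bs_phase1 {α c₀ X₀ : ℝ} (hα : α ∈ Set.Icc (1:ℝ) 2) (hc : 0 < c₀) (hX : 1 ≤ X₀)
    {p : ℝ → ℝ} (hd : Differentiable ℝ p) (hodd : ∀ x : ℝ, p (-x) = -p x)
    (hgap : ∀ x y : ℝ, X₀ ≤ x → 0 ≤ y → y ≤ x →
      c₀ / 2 * x ^ (α - 1) * (x - y) ≤ deriv p x - deriv p y)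
    {N K ξ : ℝ} (hN : 2 * X₀ ≤ N) (hK : 0 < K) (hξ : K ≤ ξ) {x₁ x₂ : ℝ}
    (h1 : N / 2 ≤ x₁) (h1' : K ≤ 2 * x₁ - ξ) (h2 : N / 2 ≤ x₂) (h2' : K ≤ 2 * x₂ - ξ) :
    c₀ / 4 * N ^ (α - 1) * K * |x₁ - x₂| ≤
      |(p x₁ + p (ξ - x₁)) - (p x₂ + p (ξ - x₂))| := by
  rcases le_total x₁ x₂ with h | h
  · have := bs_phase0 hα hc hX hd hodd hgap hN hK hξ h1 h1' h
    rw [abs_sub_comm x₁, abs_of_nonneg (by linarith : 0 ≤ x₂ - x₁), abs_sub_comm (p x₁ + _)]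
    exact this.trans (le_abs_self _)
  · have := bs_phase0 hα hc hX hd hodd hgap hN hK hξ h2 h2' h
    rw [abs_of_nonneg (by linarith : 0 ≤ x₁ - x₂)]
    exact this.trans (le_abs_self _)

lemma bs_phase {α c₀ X₀ : ℝ} (hα : α ∈ Set.Icc (1:ℝ) 2) (hc : 0 < c₀) (hX : 1 ≤ X₀)
    {p : ℝ → ℝ} (hd : Differentiable ℝ p) (hodd : ∀ x : ℝ, p (-x) = -p x)
    (hgap : ∀ x y : ℝ, X₀ ≤ x → 0 ≤ y → y ≤ x →
      c₀ / 2 * x ^ (α - 1) * (x - y) ≤ deriv p x - deriv p y)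
    {N K ξ : ℝ} (hN : 2 * X₀ ≤ N) (hK : 0 < K) (hξ : K ≤ |ξ|) {x₁ x₂ : ℝ}
    (h1 : N / 2 ≤ |x₁| ∨ N / 2 ≤ |ξ - x₁|) (h2 : N / 2 ≤ |x₂| ∨ N / 2 ≤ |ξ - x₂|)
    (h : (K ≤ 2 * x₁ - ξ ∧ K ≤ 2 * x₂ - ξ) ∨ (2 * x₁ - ξ ≤ -K ∧ 2 * x₂ - ξ ≤ -K)) :
    c₀ / 4 * N ^ (α - 1) * K * |x₁ - x₂| ≤
      |(p x₁ + p (ξ - x₁)) - (p x₂ + p (ξ - x₂))| := by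
  have key : ∀ ξ x : ℝ, K ≤ ξ → K ≤ 2 * x - ξ → (N / 2 ≤ |x| ∨ N / 2 ≤ |ξ - x|) → N / 2 ≤ x := by
    intro ξ x h1 h2 h3
    have h4 : |x| = x := abs_of_nonneg (by linarith)
    have h5 : |ξ - x| ≤ x := abs_le.2 ⟨by linarith, by linarith⟩
    rw [h4] at h3
    rcases h3 with h | h <;> linarith
  have main : ∀ ξ x₁ x₂ : ℝ, K ≤ ξ → K ≤ 2 * x₁ - ξ → K ≤ 2 * x₂ - ξ →
      (N / 2 ≤ |x₁| ∨ N / 2 ≤ |ξ - x₁|) → (N / 2 ≤ |x₂| ∨ N / 2 ≤ |ξ - x₂|) →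
      c₀ / 4 * N ^ (α - 1) * K * |x₁ - x₂| ≤
      |(p x₁ + p (ξ - x₁)) - (p x₂ + p (ξ - x₂))| := fun ξ x₁ x₂ a b c d e =>
    bs_phase1 hα hc hX hd hodd hgap hN hK a (key _ _ a b d) b (key _ _ a c e) c
  have refl : ∀ ξ x₁ x₂ : ℝ, K ≤ ξ →  2 * x₁ - ξ ≤ -K → 2 * x₂ - ξ ≤ -K →
      (N / 2 ≤ |x₁| ∨ N / 2 ≤ |ξ - x₁|) → (N / 2 ≤ |x₂| ∨ N / 2 ≤ |ξ - x₂|) →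
      c₀ / 4 * N ^ (α - 1) * K * |x₁ - x₂| ≤
      |(p x₁ + p (ξ - x₁)) - (p x₂ + p (ξ - x₂))| := by
    intro ξ x₁ x₂ a b c d e
    have := main ξ (ξ - x₁) (ξ - x₂) a (by linarith) (by linarith)
      (by rw [sub_sub_cancel]; exact d.symm) (by rw [sub_sub_cancel]; exact e.symm)
    rw [sub_sub_cancel, sub_sub_cancel, add_comm (p (ξ - x₁)), add_comm (p (ξ - x₂)),
      show ξ - x₁ - (ξ - x₂) = -(x₁ - x₂) by ring, abs_neg] at this
    exact this
  rcases le_total 0 ξ with h0 | h0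
  · rw [abs_of_nonneg h0] at hξ
    rcases h with ⟨ha, hb⟩ | ⟨ha, hb⟩
    · exact main ξ x₁ x₂ hξ ha hb h1 h2
    · exact refl ξ x₁ x₂ hξ ha hb h1 h2
  · rw [abs_of_nonpos h0] at hξ
    have hn : ∀ x, (N / 2 ≤ |x| ∨ N / 2 ≤ |ξ - x|) → (N / 2 ≤ |-x| ∨ N / 2 ≤ |-ξ - -x|) := by
      intro x hx
      rw [abs_neg, show -ξ - -x = -(ξ - x) by ring, abs_neg]; exact hx
    have fin : c₀ / 4 * N ^ (α - 1) * K * |-x₁ - -x₂| ≤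
      |(p (-x₁) + p (-ξ - -x₁)) - (p (-x₂) + p (-ξ - -x₂))| := by
      rcases h with ⟨ha, hb⟩ | ⟨ha, hb⟩
      · exact refl (-ξ) (-x₁) (-x₂) hξ (by linarith) (by linarith) (hn _ h1) (hn _ h2)
      · exact main (-ξ) (-x₁) (-x₂) hξ (by linarith) (by linarith) (hn _ h1) (hn _ h2)
    rw [show -ξ - -x₁ = -(ξ - x₁) by ring, show -ξ - -x₂ = -(ξ - x₂) by ring,
      hodd, hodd, hodd, hodd, show -x₁ - -x₂ = -(x₁ - x₂) by ring, abs_neg,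
      show -p x₁ + -p (ξ - x₁) - (-p x₂ + -p (ξ - x₂)) =
        -((p x₁ + p (ξ - x₁)) - (p x₂ + p (ξ - x₂))) by ring, abs_neg] at fin
    exact fin

lemma bs_card (ξ : ℤ) (K : ℝ) (hK : 0 < K) (S : Finset ℤ)
    (hS : ∀ k ∈ S, |2 * (k:ℝ) - ξ| < K) : (S.card : ℝ) ≤ K + 1 := by
  have hsub : S ⊆ Finset.Icc ⌈((ξ:ℝ) - K) / 2⌉ ⌊((ξ:ℝ) + K) / 2⌋ := by
    intro k hk
    have := abs_lt.1 (hS k hk)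
    rw [Finset.mem_Icc]
    exact ⟨Int.ceil_le.2 (by linarith), Int.le_floor.2 (by linarith)⟩
  have h1 := Finset.card_le_card hsub
  rw [Int.card_Icc] at h1
  have h2 : (S.card : ℝ) ≤ ((⌊((ξ:ℝ) + K) / 2⌋ + 1 - ⌈((ξ:ℝ) - K) / 2⌉).toNat : ℝ) := by
    exact_mod_cast h1
  refine h2.trans ?_
  have h3 : (((⌊((ξ:ℝ) + K) / 2⌋ + 1 - ⌈((ξ:ℝ) - K) / 2⌉).toNat : ℤ) : ℝ) =
    ((max (⌊((ξ:ℝ) + K) / 2⌋ + 1 - ⌈((ξ:ℝ) - K) / 2⌉) 0 : ℤ) : ℝ) := by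
    rw [Int.toNat_eq_max]
  rw [Int.cast_natCast] at h3
  rw [h3]
  push_cast
  apply max_le
  · have a1 := Int.floor_le (((ξ:ℝ) + K) / 2)
    have a2 := Int.le_ceil (((ξ:ℝ) - K) / 2)
    linarith
  · linarith

lemma bs_norm_exp (x t : ℝ) : ‖cexp (I * x * t)‖ = 1 := by
  rw [show I * x * t = ((x * t : ℝ) : ℂ) * I by push_cast; ring, Complex.norm_exp_ofReal_mul_I]

lemma bs_cs (S : Finset ℤ) (b : ℤ → ℂ) :
    ‖∑ k ∈ S, b k‖ ^ 2 ≤ S.card * ∑ k ∈ S, ‖b k‖ ^ 2 := by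
  calc ‖∑ k ∈ S, b k‖ ^ 2 ≤ (∑ k ∈ S, ‖b k‖) ^ 2 :=
        pow_le_pow_left₀ (norm_nonneg _) (norm_sum_le _ _) 2
    _ ≤ _ := sq_sum_le_card_mul_sum_sq

lemma bs_frozen {α c₀ X₀ : ℝ} (hα : α ∈ Set.Icc (1:ℝ) 2) (hc : 0 < c₀) (hX : 1 ≤ X₀)
    {p : ℝ → ℝ} (hd : Differentiable ℝ p) (hodd : ∀ x : ℝ, p (-x) = -p x)
    (hgap : ∀ x y : ℝ, X₀ ≤ x → 0 ≤ y → y ≤ x →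
      c₀ / 2 * x ^ (α - 1) * (x - y) ≤ deriv p x - deriv p y)
    {N K T : ℝ} (hN : 2 * X₀ ≤ N) (hK : 1 ≤ K) (hT : 0 < T) (hKT : K ^ 2 * T = N ^ (2 - α))
    {ξ : ℤ} (hξ : K ≤ |(ξ:ℝ)|) (S : Finset ℤ)
    (hS : ∀ k ∈ S, N / 2 ≤ |(k:ℝ)| ∨ N / 2 ≤ |(ξ:ℝ) - k|) (t₀ : ℝ) (b : ℤ → ℂ) :
    ∫ t in t₀..(t₀ + T / N),
        ‖∑ k ∈ S, b k * cexp (I * (p k + p ((ξ:ℝ) - k) : ℝ) * t)‖ ^ 2 ≤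
      24 * (1 + 32 / c₀) * (T / N) * K * ∑ k ∈ S, ‖b k‖ ^ 2 := by
  classical
  have hN0 : 0 < N := by linarith
  have hK0 : 0 < K := by linarith
  set δ := T / N with hδ
  have hδ0 : 0 < δ := by positivity
  set lam : ℤ → ℝ := fun k => p k + p ((ξ:ℝ) - k) with hlam
  set d := c₀ / 4 * N ^ (α - 1) * K with hdd
  have hNa : 0 < N ^ (α - 1) := Real.rpow_pos_of_pos hN0 _
  have hd0 : 0 < d := by positivity
  have hdδ : 8 / (d * δ) = 32 / c₀ * K := by
    have e1 : N ^ (α - 1) * N ^ (2 - α) = N := by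
      rw [← Real.rpow_add hN0]; ring_nf; exact Real.rpow_one N
    have e2 : d * δ * K = c₀ / 4 := by
      rw [hdd, hδ]
      calc c₀ / 4 * N ^ (α - 1) * K * (T / N) * K = c₀ / 4 * N ^ (α - 1) * (K ^ 2 * T) / N := by ring
        _ = c₀ / 4 * (N ^ (α - 1) * N ^ (2 - α)) / N := by rw [hKT]; ring
        _ = _ := by rw [e1]; field_simp
    have e3 : 0 < d * δ := by positivity
    rw [div_eq_iff e3.ne']
    calc (8:ℝ) = 32 / c₀ * (c₀ / 4) := by field_simp; norm_num
      _ = _ := by rw [← e2]; ring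
  set S0 := S.filter (fun k : ℤ => |2 * (k:ℝ) - ξ| < K)
  set S1 := S.filter (fun k : ℤ => K ≤ 2 * (k:ℝ) - ξ)
  set S2 := S.filter (fun k : ℤ => 2 * (k:ℝ) - ξ ≤ -K)
  have hsplit : ∀ {M : Type} [AddCommMonoid M] (f : ℤ → M),
      ∑ k ∈ S, f k = ∑ k ∈ S0, f k + ∑ k ∈ S1, f k + ∑ k ∈ S2, f k := by
    intro M _ f
    simp only [S0, S1, S2, Finset.sum_filter, ← Finset.sum_add_distrib]
    refine Finset.sum_congr rfl fun k _ => ?_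
    by_cases h1 : K ≤ 2 * (k:ℝ) - ξ
    · have h0 : ¬ |2 * (k:ℝ) - ξ| < K := by
        rw [not_lt]; exact h1.trans (le_abs_self _)
      have h2 : ¬ 2 * (k:ℝ) - ξ ≤ -K := by rw [not_le]; linarith
      simp [h1, h0, h2]
    · by_cases h2 : 2 * (k:ℝ) - ξ ≤ -K
      · have h0 : ¬ |2 * (k:ℝ) - ξ| < K := by
          rw [not_lt]
          have := neg_le_abs (2 * (k:ℝ) - ξ)
          linarith
        simp [h1, h0, h2]
      · have h0 : |2 * (k:ℝ) - ξ| < K := abs_lt.2 ⟨by linarith, by linarith⟩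
        simp [h1, h0, h2]
  have hb1 : ∫ t in t₀..(t₀ + δ), ‖∑ k ∈ S1, b k * cexp (I * lam k * t)‖ ^ 2 ≤
      8 * δ * (1 + 8 / (d * δ)) * ∑ k ∈ S1, ‖b k‖ ^ 2 := by
    refine bs_sieve t₀ δ d hδ0 hd0 S1 lam b fun k hk l hl => ?_
    rw [Finset.mem_filter] at hk hl
    exact bs_phase hα hc hX hd hodd hgap hN hK0 hξ (hS k hk.1) (hS l hl.1) (Or.inl ⟨hk.2, hl.2⟩)
  have hb2 : ∫ t in t₀..(t₀ + δ), ‖∑ k ∈ S2, b k * cexp (I * lam k * t)‖ ^ 2 ≤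
      8 * δ * (1 + 8 / (d * δ)) * ∑ k ∈ S2, ‖b k‖ ^ 2 := by
    refine bs_sieve t₀ δ d hδ0 hd0 S2 lam b fun k hk l hl => ?_
    rw [Finset.mem_filter] at hk hl
    exact bs_phase hα hc hX hd hodd hgap hN hK0 hξ (hS k hk.1) (hS l hl.1) (Or.inr ⟨hk.2, hl.2⟩)
  have hIntg : ∀ S' : Finset ℤ, IntervalIntegrable
      (fun t : ℝ => ‖∑ k ∈ S', b k * cexp (I * lam k * t)‖ ^ 2) volume t₀ (t₀ + δ) := fun S' =>
    Continuous.intervalIntegrable (by fun_prop) _ _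
  have hb0 : ∫ t in t₀..(t₀ + δ), ‖∑ k ∈ S0, b k * cexp (I * lam k * t)‖ ^ 2 ≤
      δ * (2 * K * ∑ k ∈ S0, ‖b k‖ ^ 2) := by
    have : ∫ t in t₀..(t₀ + δ), (2 * K * ∑ k ∈ S0, ‖b k‖ ^ 2) =
      δ * (2 * K * ∑ k ∈ S0, ‖b k‖ ^ 2) := by
      rw [intervalIntegral.integral_const, smul_eq_mul, add_sub_cancel_left]
    rw [← this]
    refine intervalIntegral.integral_mono_on (by linarith) (hIntg S0) (by simp) fun t _ => ?_
    refine (bs_cs S0 _).trans ?_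
    simp only [norm_mul, bs_norm_exp, mul_one]
    have hcard := bs_card ξ K hK0 S0 (fun k hk => (Finset.mem_filter.1 hk).2)
    gcongr
    linarith
  have hle : ∫ t in t₀..(t₀ + δ), ‖∑ k ∈ S, b k * cexp (I * lam k * t)‖ ^ 2 ≤
     ∫ t in t₀..(t₀ + δ), (3 * (‖∑ k ∈ S0, b k * cexp (I * lam k * t)‖ ^ 2 +
       ‖∑ k ∈ S1, b k * cexp (I * lam k * t)‖ ^ 2 + ‖∑ k ∈ S2, b k * cexp (I * lam k * t)‖ ^ 2)) := by
    refine intervalIntegral.integral_mono_on (by linarith) (hIntg S)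
      ((((hIntg S0).add (hIntg S1)).add (hIntg S2)).const_mul 3) fun t _ => ?_
    rw [hsplit (fun k => b k * cexp (I * lam k * t))]
    have := norm_add₃_le (a := ∑ k ∈ S0, b k * cexp (I * lam k * t))
      (b := ∑ k ∈ S1, b k * cexp (I * lam k * t)) (c := ∑ k ∈ S2, b k * cexp (I * lam k * t))
    refine (pow_le_pow_left₀ (norm_nonneg _) this 2).trans ?_
    generalize ‖∑ k ∈ S0, b k * cexp (I * lam k * t)‖ = x
    generalize ‖∑ k ∈ S1, b k * cexp (I * lam k * t)‖ = y
    generalize ‖∑ k ∈ S2, b k * cexp (I * lam k * t)‖ = z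
    nlinarith [sq_nonneg (x - y), sq_nonneg (y - z), sq_nonneg (x - z)]
  refine hle.trans ?_
  rw [intervalIntegral.integral_const_mul, intervalIntegral.integral_add ((hIntg S0).add (hIntg S1)) (hIntg S2),
    intervalIntegral.integral_add (hIntg S0) (hIntg S1), hsplit (fun k => ‖b k‖ ^ 2)]
  have hx0 : 0 ≤ ∑ k ∈ S0, ‖b k‖ ^ 2 := by positivity
  have hx1 : 0 ≤ ∑ k ∈ S1, ‖b k‖ ^ 2 := by positivity
  have hx2 : 0 ≤ ∑ k ∈ S2, ‖b k‖ ^ 2 := by positivity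
  rw [hdδ] at hb1 hb2
  have hcc : 0 ≤ 32 / c₀ := by positivity
  have hcoef : 8 * δ * (1 + 32 / c₀ * K) ≤ 8 * (1 + 32 / c₀) * δ * K := by
    have : 1 + 32 / c₀ * K ≤ (1 + 32 / c₀) * K := by linarith
    calc 8 * δ * (1 + 32 / c₀ * K) ≤ 8 * δ * ((1 + 32 / c₀) * K) := by gcongr
      _ = _ := by ring
  have hcoef0 : 2 * δ * K ≤ 8 * (1 + 32 / c₀) * δ * K := by
    have : 0 ≤ δ * K := by positivity
    nlinarith [mul_nonneg hcc this]
  have g1 := mul_le_mul_of_nonneg_right hcoef hx1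
  have g2 := mul_le_mul_of_nonneg_right hcoef hx2
  have g0 := mul_le_mul_of_nonneg_right hcoef0 hx0
  linarith

/-- bounded measurable functions are integrable on finite measure spaces -/
lemma bs_bdd_int {X E : Type*} [MeasurableSpace X] [NormedAddCommGroup E] {μ : Measure X}
    [IsFiniteMeasure μ]
    {f : X → E} (hf : AEStronglyMeasurable f μ) (M : ℝ) (hM : ∀ x, ‖f x‖ ≤ M) : Integrable f μ :=
  Integrable.of_bound hf M (Eventually.of_forall hM)

lemma bs_cs_int {X : Type*} [MeasurableSpace X] {μ : Measure X} [IsFiniteMeasure μ] {δ : ℝ}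
    (hδ : 0 < δ) (hμ : μ.real univ = δ)
    {f : X → ℝ} (hf : Measurable f) (M : ℝ) (hM : ∀ x, ‖f x‖ ≤ M) :
    (∫ x, f x ∂μ) ^ 2 ≤ δ * ∫ x, f x ^ 2 ∂μ := by
  set m := ∫ x, f x ∂μ with hm
  have i1 : Integrable f μ := bs_bdd_int hf.aestronglyMeasurable M hM
  have i2 : Integrable (fun x => f x ^ 2) μ :=
    bs_bdd_int (hf.pow_const 2).aestronglyMeasurable (M ^ 2) (fun x => by
      rw [norm_pow]; exact pow_le_pow_left₀ (norm_nonneg _) (hM x) 2)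
  have h0 : 0 ≤ ∫ x, (δ * f x - m) ^ 2 ∂μ := integral_nonneg fun x => sq_nonneg _
  have h1 : ∫ x, (δ * f x - m) ^ 2 ∂μ = δ ^ 2 * ∫ x, f x ^ 2 ∂μ - 2 * δ * m * m + m ^ 2 * δ := by
    have : ∀ x, (δ * f x - m) ^ 2 = δ ^ 2 * f x ^ 2 - 2 * δ * m * f x + m ^ 2 := fun x => by ring
    simp only [this]
    have i3 : Integrable (fun x => δ ^ 2 * f x ^ 2 - 2 * δ * m * f x) μ :=
      (i2.const_mul _).sub (i1.const_mul _)
    rw [integral_add i3 (integrable_const _),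
      integral_sub (i2.const_mul _) (i1.const_mul _), integral_const_mul, integral_const_mul,
      integral_const, hμ, smul_eq_mul]
    ring
  rw [h1] at h0
  have : 0 ≤ δ * (δ * ∫ x, f x ^ 2 ∂μ - m ^ 2) := by linarith
  have := nonneg_of_mul_nonneg_right this hδ
  linarith

lemma bs_dyn (t₀ δ A : ℝ) (hδ : 0 < δ) (S : Finset ℤ) (lam : ℤ → ℝ)
    (hS : ∀ b : ℤ → ℂ, ∫ t in t₀..(t₀ + δ), ‖∑ k ∈ S, b k * cexp (I * lam k * t)‖ ^ 2 ≤
      A * ∑ k ∈ S, ‖b k‖ ^ 2)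
    (b g : ℤ → ℝ → ℂ) (hb : ∀ k, Continuous (b k)) (hg : ∀ k, Measurable (g k)) (M : ℝ)
    (hM : ∀ k ∈ S, ∀ t, ‖g k t‖ ≤ M)
    (hbg : ∀ k ∈ S, ∀ t ∈ Icc t₀ (t₀ + δ), ∀ t' ∈ Icc t₀ (t₀ + δ), b k t - b k t' = ∫ s in t'..t, g k s) :
    ∫ t in t₀..(t₀ + δ), ‖∑ k ∈ S, b k t * cexp (I * lam k * t)‖ ^ 2 ≤
      2 * A / δ * (∫ t in t₀..(t₀ + δ), ∑ k ∈ S, ‖b k t‖ ^ 2) +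
      2 * A * δ * (∫ t in t₀..(t₀ + δ), ∑ k ∈ S, ‖g k t‖ ^ 2) := by
  have hle : t₀ ≤ t₀ + δ := by linarith
  simp only [intervalIntegral.integral_of_le hle] at hS ⊢
  set μ := volume.restrict (Ioc t₀ (t₀ + δ)) with hμ
  have hfin : IsFiniteMeasure μ := by rw [hμ]; infer_instance
  have hμδ : μ.real univ = δ := by
    rw [hμ]; simp [Measure.real, hδ.le]
  have cint : ∀ f : ℝ → ℝ, Continuous f → Integrable f μ := fun f hf =>
    hf.integrableOn_Ioc
  set h : ℝ → ℝ → ℂ := fun t s => ∑ k ∈ S, g k s * cexp (I * lam k * t) with hh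
  have hhM : ∀ t s, ‖h t s‖ ≤ S.card * M := by
    intro t s
    refine (norm_sum_le _ _).trans ?_
    rw [← nsmul_eq_mul]
    refine Finset.sum_le_card_nsmul _ _ _ fun k hk => ?_
    rw [norm_mul, bs_norm_exp, mul_one]; exact hM k hk s
  have hhm : Measurable (fun z : ℝ × ℝ => h z.1 z.2) := by
    refine Finset.measurable_sum _ fun k _ => ?_
    refine ((hg k).comp measurable_snd).mul ?_
    exact (Continuous.measurable (by fun_prop))
  have hhm1 : ∀ t, Measurable (fun s => h t s) := fun t => hhm.comp measurable_prodMk_left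
  have hh2 : Integrable (fun z : ℝ × ℝ => ‖h z.1 z.2‖ ^ 2) (μ.prod μ) :=
    bs_bdd_int (hhm.norm.pow_const 2).aestronglyMeasurable ((S.card * M) ^ 2) (fun z => by
      rw [norm_pow, norm_norm]; exact pow_le_pow_left₀ (norm_nonneg _) (hhM _ _) 2)
  -- pointwise
  have hpt : ∀ t ∈ Ioc t₀ (t₀ + δ), ∀ t' ∈ Ioc t₀ (t₀ + δ),
      ‖∑ k ∈ S, b k t * cexp (I * lam k * t)‖ ^ 2 ≤
      2 * ‖∑ k ∈ S, b k t' * cexp (I * lam k * t)‖ ^ 2 + 2 * δ * ∫ s, ‖h t s‖ ^ 2 ∂μ := by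
    intro t ht t' ht'
    have e1 : ∑ k ∈ S, b k t * cexp (I * lam k * t) =
       ∑ k ∈ S, b k t' * cexp (I * lam k * t) + ∫ s in t'..t, h t s := by
      rw [hh]
      rw [intervalIntegral.integral_finsetSum, ← Finset.sum_add_distrib]
      · refine Finset.sum_congr rfl fun k hk => ?_
        rw [intervalIntegral.integral_mul_const, ← hbg k hk t (Ioc_subset_Icc_self ht) t' (Ioc_subset_Icc_self ht')]
        ring
      · intro k hk
        refine IntervalIntegrable.mul_const ?_ _
        rw [intervalIntegrable_iff, IntegrableOn, uIoc]
        exact bs_bdd_int (hg k).aestronglyMeasurable M (hM k hk)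
    have e2 : ‖∫ s in t'..t, h t s‖ ≤ ∫ s, ‖h t s‖ ∂μ := by
      refine (intervalIntegral.norm_integral_le_integral_norm_uIoc).trans ?_
      refine setIntegral_mono_set ?_ (Eventually.of_forall fun _ => norm_nonneg _) ?_
      · exact bs_bdd_int (hhm1 t).norm.aestronglyMeasurable (S.card * M) (fun s => by
          rw [norm_norm]; exact hhM t s)
      · refine LE.le.eventuallyLE ?_
        intro s hs
        rw [uIoc, mem_Ioc] at hs
        exact ⟨(lt_min ht'.1 ht.1).trans hs.1, hs.2.trans (max_le ht'.2 ht.2)⟩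
    have e3 := bs_cs_int (μ := μ) hδ hμδ (hhm1 t).norm (S.card * M) (fun s => by
          rw [norm_norm]; exact hhM t s)
    rw [e1]
    have e4 : ‖∫ s in t'..t, h t s‖ ^ 2 ≤ δ * ∫ s, ‖h t s‖ ^ 2 ∂μ :=
      (pow_le_pow_left₀ (norm_nonneg _) e2 2).trans e3
    have e5 := pow_le_pow_left₀ (norm_nonneg _)
      (norm_add_le (∑ k ∈ S, b k t' * cexp (I * lam k * t)) (∫ s in t'..t, h t s)) 2
    nlinarith [sq_nonneg (‖∑ k ∈ S, b k t' * cexp (I * lam k * t)‖ - ‖∫ s in t'..t, h t s‖)]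
  have hB : ∫ t, ∫ s, ‖h t s‖ ^ 2 ∂μ ∂μ ≤ A * ∫ s, ∑ k ∈ S, ‖g k s‖ ^ 2 ∂μ := by
    rw [integral_integral_swap hh2, ← integral_const_mul]
    refine integral_mono hh2.integral_prod_right ?_ fun s => hS (fun k => g k s)
    refine Integrable.const_mul (integrable_finsetSum _ fun k hk => ?_) _
    exact bs_bdd_int ((hg k).norm.pow_const 2).aestronglyMeasurable (M ^ 2) (fun z => by
      rw [norm_pow, norm_norm]; exact pow_le_pow_left₀ (norm_nonneg _) (hM k hk _) 2)
  set G := ∫ s, ∑ k ∈ S, ‖g k s‖ ^ 2 ∂μ with hG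
  set Q := ∫ t, ‖∑ k ∈ S, b k t * cexp (I * lam k * t)‖ ^ 2 ∂μ with hQ
  have hC : ∀ t' ∈ Ioc t₀ (t₀ + δ), Q ≤ 2 * A * ∑ k ∈ S, ‖b k t'‖ ^ 2 + 2 * δ * (A * G) := by
    intro t' ht'
    have i1 : Integrable (fun t : ℝ => 2 * ‖∑ k ∈ S, b k t' * cexp (I * lam k * t)‖ ^ 2) μ :=
      cint _ (by fun_prop)
    have i2 : Integrable (fun t => 2 * δ * ∫ s, ‖h t s‖ ^ 2 ∂μ) μ := hh2.integral_prod_left.const_mul _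
    have : Q ≤ ∫ t, (2 * ‖∑ k ∈ S, b k t' * cexp (I * lam k * t)‖ ^ 2 +
        2 * δ * ∫ s, ‖h t s‖ ^ 2 ∂μ) ∂μ := by
      refine setIntegral_mono_on (cint _ (by fun_prop)) (i1.add i2) measurableSet_Ioc ?_
      exact fun t ht => hpt t ht t' ht'
    rw [integral_add i1 i2, integral_const_mul, integral_const_mul] at this
    have h2 := hS (fun k => b k t')
    have h3 : 2 * δ * ∫ t, ∫ s, ‖h t s‖ ^ 2 ∂μ ∂μ ≤ 2 * δ * (A * G) := by gcongr
    linarith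
  have hD : δ * Q ≤ 2 * A * (∫ t, ∑ k ∈ S, ‖b k t‖ ^ 2 ∂μ) + δ * (2 * δ * (A * G)) := by
    have i1 : Integrable (fun t => 2 * A * ∑ k ∈ S, ‖b k t‖ ^ 2) μ := cint _ (by fun_prop)
    have : ∫ _t', Q ∂μ ≤ ∫ t', (2 * A * ∑ k ∈ S, ‖b k t'‖ ^ 2 + 2 * δ * (A * G)) ∂μ :=
      setIntegral_mono_on (integrable_const _) (i1.add (integrable_const _)) measurableSet_Ioc hC
    rw [integral_add i1 (integrable_const _), integral_const, integral_const, hμδ,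
      integral_const_mul, smul_eq_mul, smul_eq_mul] at this
    exact this
  have : Q ≤ (2 * A * (∫ t, ∑ k ∈ S, ‖b k t‖ ^ 2 ∂μ) + δ * (2 * δ * (A * G))) / δ := by
    rw [le_div_iff₀ hδ]; linarith
  refine this.trans (le_of_eq ?_)
  field_simp

lemma bs_ii {g : ℝ → ℂ} (hg : Measurable g) (M : ℝ) (hM : ∀ t, ‖g t‖ ≤ M) (a b : ℝ) :
    IntervalIntegrable g volume a b := by
  rw [intervalIntegrable_iff, IntegrableOn, uIoc]
  exact bs_bdd_int hg.aestronglyMeasurable M hM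

lemma bs_prod {g₁ g₂ w₁ w₂ : ℝ → ℂ} (hg₁ : Measurable g₁) (hg₂ : Measurable g₂) (M₁ M₂ : ℝ)
    (hM₁ : ∀ t, ‖g₁ t‖ ≤ M₁) (hM₂ : ∀ t, ‖g₂ t‖ ≤ M₂) (c₁ c₂ : ℂ)
    (hw₁ : ∀ t, w₁ t = c₁ + ∫ s in (0:ℝ)..t, g₁ s) (hw₂ : ∀ t, w₂ t = c₂ + ∫ s in (0:ℝ)..t, g₂ s)
    (t t' : ℝ) :
    w₁ t * w₂ t - w₁ t' * w₂ t' = ∫ s in t'..t, (g₁ s * w₂ s + w₁ s * g₂ s) := by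
  have hcw : ∀ {g w : ℝ → ℂ} {c : ℂ} {M : ℝ}, Measurable g → (∀ t, ‖g t‖ ≤ M) →
      (∀ t, w t = c + ∫ s in (0:ℝ)..t, g s) → Continuous w := by
    intro g w c M hg hM hw
    rw [show w = _ from funext hw]
    exact continuous_const.add (intervalIntegral.continuous_primitive (fun a b => bs_ii hg M hM a b) 0)
  have c1 := hcw hg₁ hM₁ hw₁
  have c2 := hcw hg₂ hM₂ hw₂
  have hac : ∀ {g w : ℝ → ℂ} {c : ℂ} {M : ℝ}, Measurable g → (∀ t, ‖g t‖ ≤ M) →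
      (∀ t, w t = c + ∫ s in (0:ℝ)..t, g s) → AbsolutelyContinuousOnInterval w t' t := by
    intro g w c M hg hM hw
    apply LipschitzOnWith.absolutelyContinuousOnInterval (K := M.toNNReal)
    apply LipschitzOnWith.of_dist_le_mul
    intro x _ y _
    rw [dist_eq_norm, hw x, hw y, add_sub_add_left_eq_sub,
      intervalIntegral.integral_interval_sub_left (bs_ii hg M hM _ _) (bs_ii hg M hM _ _)]
    refine (intervalIntegral.norm_integral_le_of_norm_le_const (C := M) fun s _ => hM s).trans ?_
    rw [Real.coe_toNNReal _ ((norm_nonneg _).trans (hM 0)), Real.dist_eq]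
  set G : ℝ → ℂ := fun s => g₁ s * w₂ s + w₁ s * g₂ s with hG
  have hGi : ∀ a b, IntervalIntegrable G volume a b := fun a b =>
    ((bs_ii hg₁ M₁ hM₁ a b).mul_continuousOn c2.continuousOn).add
      ((bs_ii hg₂ M₂ hM₂ a b).continuousOn_mul c1.continuousOn)
  have hPac : AbsolutelyContinuousOnInterval (fun x => ∫ s in t'..x, G s) t' t := by
    obtain ⟨B1, hB1⟩ := (isCompact_uIcc (a := t') (b := t)).exists_bound_of_continuousOn c1.continuousOn
    obtain ⟨B2, hB2⟩ := (isCompact_uIcc (a := t') (b := t)).exists_bound_of_continuousOn c2.continuousOn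
    have hGb : ∀ s ∈ uIcc t' t, ‖G s‖ ≤ M₁ * B2 + B1 * M₂ := by
      intro s hs
      refine (norm_add_le _ _).trans ?_
      rw [norm_mul, norm_mul]
      have h1 := hB1 s hs
      have h2 := hB2 s hs
      have h3 := (norm_nonneg _).trans h1
      have h4 := (norm_nonneg _).trans (hM₁ s)
      exact add_le_add (mul_le_mul (hM₁ s) h2 (norm_nonneg _) h4)
        (mul_le_mul h1 (hM₂ s) (norm_nonneg _) h3)
    apply LipschitzOnWith.absolutelyContinuousOnInterval (K := (M₁ * B2 + B1 * M₂).toNNReal)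
    apply LipschitzOnWith.of_dist_le_mul
    intro x hx y hy
    rw [dist_eq_norm, intervalIntegral.integral_interval_sub_left (hGi _ _) (hGi _ _)]
    refine (intervalIntegral.norm_integral_le_of_norm_le_const (C := M₁ * B2 + B1 * M₂)
      fun s hs => hGb s ?_).trans ?_
    · exact uIcc_subset_uIcc hy hx (uIoc_subset_uIcc hs)
    rw [Real.coe_toNNReal _ ((norm_nonneg _).trans (hGb t' left_mem_uIcc)), Real.dist_eq]
  have hF := ((hac hg₁ hM₁ hw₁).smul (hac hg₂ hM₂ hw₂)).sub hPac
  obtain ⟨C, hC⟩ := hF.const_of_ae_hasDerivAt_zero (by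
    filter_upwards [(hGi t' t).ae_hasDerivAt_integral,
      (bs_ii hg₁ M₁ hM₁ t' t).ae_hasDerivAt_integral,
      (bs_ii hg₂ M₂ hM₂ t' t).ae_hasDerivAt_integral] with x h0 h1 h2 hx
    have h0' := h0 hx t' left_mem_uIcc
    have hd : ∀ {g w : ℝ → ℂ} {c : ℂ} {M : ℝ}, Measurable g → (∀ t, ‖g t‖ ≤ M) →
      (∀ t, w t = c + ∫ s in (0:ℝ)..t, g s) →
      HasDerivAt (fun x => ∫ s in t'..x, g s) (g x) x → HasDerivAt w (g x) x := by
      intro g w c M hg hM hw h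
      have : w = fun x => (c + ∫ s in (0:ℝ)..t', g s) + ∫ s in t'..x, g s := by
        funext y
        rw [hw y, add_assoc, intervalIntegral.integral_add_adjacent_intervals
          (bs_ii hg M hM _ _) (bs_ii hg M hM _ _)]
      rw [this]
      exact h.const_add _
    have h1' := hd hg₁ hM₁ hw₁ (h1 hx t' left_mem_uIcc)
    have h2' := hd hg₂ hM₂ hw₂ (h2 hx t' left_mem_uIcc)
    have := (h1'.mul h2').sub h0'
    rw [show g₁ x * w₂ x + w₁ x * g₂ x - G x = 0 by simp [hG]] at this
    exact this)
  have e1 := hC t right_mem_uIcc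
  have e2 := hC t' left_mem_uIcc
  simp only [Pi.sub_apply, smul_eq_mul, intervalIntegral.integral_same, sub_zero,
    Pi.mul_apply] at e1 e2
  rw [e2, ← e1]; ring

lemma bs_high {α c₀ X₀ : ℝ} (hα : α ∈ Set.Icc (1:ℝ) 2) (hc : 0 < c₀) (hX : 1 ≤ X₀)
    {p : ℝ → ℝ} (hd : Differentiable ℝ p) (hodd : ∀ x : ℝ, p (-x) = -p x)
    (hgap : ∀ x y : ℝ, X₀ ≤ x → 0 ≤ y → y ≤ x →
      c₀ / 2 * x ^ (α - 1) * (x - y) ≤ deriv p x - deriv p y)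
    {N : ℕ} {K T : ℝ} (hN : 2 * X₀ ≤ N) (hK : 1 ≤ K) (hT : 0 < T)
    (hKT : K ^ 2 * T = (N:ℝ) ^ (2 - α))
    {ξ : ℤ} (hξ : K ≤ |(ξ:ℝ)|) (S : Finset ℤ)
    (hS : ∀ k ∈ S, (N:ℝ) / 2 ≤ |(k:ℝ)| ∨ (N:ℝ) / 2 ≤ |(ξ:ℝ) - k|)
    (b g : ℤ → ℝ → ℂ) (hb : ∀ k, Continuous (b k)) (hg : ∀ k, Measurable (g k)) (M : ℝ)
    (hM : ∀ k ∈ S, ∀ t, ‖g k t‖ ≤ M)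
    (hbg : ∀ k ∈ S, ∀ t ∈ Icc 0 T, ∀ t' ∈ Icc 0 T, b k t - b k t' = ∫ s in t'..t, g k s) :
    ∫ t in (0:ℝ)..T,
        ‖∑ k ∈ S, b k t * cexp (I * (p k + p ((ξ:ℝ) - k) : ℝ) * t)‖ ^ 2 ≤
      2 * (24 * (1 + 32 / c₀)) * K * ((∫ t in (0:ℝ)..T, ∑ k ∈ S, ‖b k t‖ ^ 2) +
        (T / N) ^ 2 * ∫ t in (0:ℝ)..T, ∑ k ∈ S, ‖g k t‖ ^ 2) := by
  have hN0 : (0:ℝ) < N := by linarith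
  set δ := T / N with hδ
  have hδ0 : 0 < δ := by positivity
  have hNδ : (N:ℝ) * δ = T := by rw [hδ]; field_simp
  have hstep : ∀ j : ℕ, ((j + 1 : ℕ) : ℝ) * δ = (j:ℝ) * δ + δ := by intro j; push_cast; ring
  have hdec : ∀ f : ℝ → ℝ, (∀ a b, IntervalIntegrable f volume a b) →
      ∫ t in (0:ℝ)..T, f t = ∑ j ∈ Finset.range N, ∫ t in ((j:ℝ) * δ)..((j:ℝ) * δ + δ), f t := by
    intro f hf
    have := intervalIntegral.sum_integral_adjacent_intervals (f := f) (μ := volume)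
      (a := fun j : ℕ => (j:ℝ) * δ) (n := N) (fun k _ => hf _ _)
    simp only [hstep, Nat.cast_zero, zero_mul, hNδ] at this
    exact this.symm
  have ib : ∀ a b', IntervalIntegrable (fun t => ∑ k ∈ S, ‖b k t‖ ^ 2) volume a b' := fun a b' =>
    Continuous.intervalIntegrable (by fun_prop) _ _
  have ig : ∀ a b', IntervalIntegrable (fun t => ∑ k ∈ S, ‖g k t‖ ^ 2) volume a b' := by
    intro a b'
    rw [intervalIntegrable_iff, IntegrableOn, uIoc]
    refine integrable_finsetSum _ fun k hk => ?_
    exact bs_bdd_int ((hg k).norm.pow_const 2).aestronglyMeasurable (M ^ 2) (fun z => by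
      rw [norm_pow, norm_norm]; exact pow_le_pow_left₀ (norm_nonneg _) (hM k hk _) 2)
  rw [hdec _ ib, hdec _ ig, hdec _ (fun a b' => Continuous.intervalIntegrable (by fun_prop) _ _),
    Finset.mul_sum, ← Finset.sum_add_distrib, Finset.mul_sum]
  refine Finset.sum_le_sum fun j hj => ?_
  rw [Finset.mem_range] at hj
  have hsub : Icc ((j:ℝ) * δ) ((j:ℝ) * δ + δ) ⊆ Icc 0 T := by
    refine Icc_subset_Icc (by positivity) ?_
    rw [← hstep, ← hNδ]
    have : ((j + 1 : ℕ) : ℝ) ≤ N := by exact_mod_cast hj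
    gcongr
  have := bs_dyn ((j:ℝ) * δ) δ (24 * (1 + 32 / c₀) * δ * K) hδ0 S
    (fun k => p k + p ((ξ:ℝ) - k))
    (fun b => bs_frozen hα hc hX hd hodd hgap hN hK hT hKT hξ S hS _ b) b g hb hg M hM
    (fun k hk t ht t' ht' => hbg k hk t (hsub ht) t' (hsub ht'))
  refine this.trans (le_of_eq ?_)
  field_simp

lemma bs_conv (S₁ S₂ Ξ : Finset ℤ) (f h : ℤ → ℝ) (hf : ∀ k, 0 ≤ f k) (hh : ∀ k, 0 ≤ h k) :
    ∑ ξ ∈ Ξ, ∑ k ∈ S₁.filter (fun k => ξ - k ∈ S₂), f k * h (ξ - k) ≤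
      (∑ k ∈ S₁, f k) * ∑ k ∈ S₂, h k := by
  simp only [Finset.sum_filter]
  rw [Finset.sum_comm, Finset.sum_mul]
  refine Finset.sum_le_sum fun k _ => ?_
  rw [← Finset.sum_filter, ← Finset.mul_sum]
  refine mul_le_mul_of_nonneg_left ?_ (hf k)
  rw [← Finset.sum_image (f := h) (g := fun ξ => ξ - k) (fun x _ y _ hxy => by simpa using hxy)]
  refine Finset.sum_le_sum_of_subset_of_nonneg ?_ (fun _ _ _ => hh _)
  intro l hl
  rw [Finset.mem_image] at hl
  obtain ⟨ξ, hξ, rfl⟩ := hl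
  exact (Finset.mem_filter.1 hξ).2

lemma bs_shift (S₁ S₂ : Finset ℤ) (ξ : ℤ) (h : ℤ → ℝ) (hh : ∀ k, 0 ≤ h k) :
    ∑ k ∈ S₁.filter (fun k => ξ - k ∈ S₂), h (ξ - k) ≤ ∑ k ∈ S₂, h k := by
  rw [← Finset.sum_image (f := h) (g := fun k => ξ - k) (fun x _ y _ hxy => by simpa using hxy)]
  refine Finset.sum_le_sum_of_subset_of_nonneg ?_ (fun _ _ _ => hh _)
  intro l hl
  rw [Finset.mem_image] at hl
  obtain ⟨k, hk, rfl⟩ := hl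
  exact (Finset.mem_filter.1 hk).2

lemma bs_low_pt (S₁ S₂ : Finset ℤ) (ξ : ℤ) (A e w v : ℤ → ℂ) (hA : ∀ k, ‖A k‖ ≤ 1)
    (he : ∀ k, ‖e k‖ = 1) :
    ‖∑ k ∈ S₁.filter (fun k => ξ - k ∈ S₂), A k * w k * v (ξ - k) * e k‖ ^ 2 ≤
      (∑ k ∈ S₁, ‖w k‖ ^ 2) * ∑ k ∈ S₂, ‖v k‖ ^ 2 := by
  have h1 : ‖∑ k ∈ S₁.filter (fun k => ξ - k ∈ S₂), A k * w k * v (ξ - k) * e k‖ ≤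
      ∑ k ∈ S₁.filter (fun k => ξ - k ∈ S₂), ‖w k‖ * ‖v (ξ - k)‖ := by
    refine (norm_sum_le _ _).trans (Finset.sum_le_sum fun k _ => ?_)
    rw [norm_mul, norm_mul, norm_mul, he, mul_one, mul_assoc]
    exact mul_le_of_le_one_left (by positivity) (hA k)
  refine (pow_le_pow_left₀ (norm_nonneg _) h1 2).trans ?_
  refine (Finset.sum_mul_sq_le_sq_mul_sq _ _ _).trans ?_
  refine mul_le_mul ?_ (bs_shift S₁ S₂ ξ (fun k => ‖v k‖ ^ 2) (fun _ => by positivity))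
    (Finset.sum_nonneg fun _ _ => by positivity) (Finset.sum_nonneg fun _ _ => by positivity)
  exact Finset.sum_le_sum_of_subset_of_nonneg (Finset.filter_subset _ _)
    (fun _ _ _ => by positivity)

lemma bs_core {α c₀ X₀ : ℝ} (hα : α ∈ Set.Icc (1:ℝ) 2) (hc : 0 < c₀) (hX : 1 ≤ X₀)
    {p : ℝ → ℝ} (hd : Differentiable ℝ p) (hodd : ∀ x : ℝ, p (-x) = -p x)
    (hgap : ∀ x y : ℝ, X₀ ≤ x → 0 ≤ y → y ≤ x →
      c₀ / 2 * x ^ (α - 1) * (x - y) ≤ deriv p x - deriv p y)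
    {N : ℕ} {K T : ℝ} (hN : 1 ≤ N) (hK : 1 ≤ K) (hT : 0 < T) (hT1 : T < 1)
    (hKT : K ^ 2 * T = (N:ℝ) ^ (2 - α))
    (S₁ S₂ Ξ : Finset ℤ)
    (hS : (∀ k ∈ S₁, (N:ℝ) / 2 ≤ |(k:ℝ)|) ∨ (∀ k ∈ S₂, (N:ℝ) / 2 ≤ |(k:ℝ)|))
    (hΞ : ∀ ξ ∈ Ξ, |(ξ:ℝ)| ≤ 4 * N)
    (a : ℝ → ℝ → ℂ) (ha : ∀ x y : ℝ, ‖a x y‖ ≤ 1)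
    (w₁ w₂ g₁ g₂ : ℤ → ℝ → ℂ) (c₁ c₂ : ℤ → ℂ) (M : ℝ)
    (hg₁ : ∀ k, Measurable (g₁ k)) (hg₂ : ∀ k, Measurable (g₂ k))
    (hM₁ : ∀ k t, ‖g₁ k t‖ ≤ M) (hM₂ : ∀ k t, ‖g₂ k t‖ ≤ M)
    (hw₁ : ∀ k t, w₁ k t = c₁ k + ∫ s in (0:ℝ)..t, g₁ k s)
    (hw₂ : ∀ k t, w₂ k t = c₂ k + ∫ s in (0:ℝ)..t, g₂ k s)
    (B : ℝ)
    (hE : ∀ t ∈ Ioo 0 T, ∑ k ∈ S₂, ‖w₂ k t‖ ^ 2 ≤ B ^ 2)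
    (hH : ∀ t ∈ Ioo 0 T, ∑ k ∈ S₂, ‖g₂ k t‖ ^ 2 ≤ 4 * (N:ℝ) ^ 2 * B ^ 2) :
    ∫ t in (0:ℝ)..T, ∑ ξ ∈ Ξ, ‖∑ k ∈ S₁.filter (fun k => ξ - k ∈ S₂),
        a k ((ξ:ℝ) - k) * w₁ k t * w₂ (ξ - k) t * cexp (I * (p k + p ((ξ:ℝ) - k) : ℝ) * t)‖ ^ 2 ≤
      (24 * X₀ + 432 * (1 + 32 / c₀)) * K * B ^ 2 *
        ((∫ t in (0:ℝ)..T, ∑ k ∈ S₁, ‖w₁ k t‖ ^ 2) +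
          ((N:ℝ) ^ 2)⁻¹ * ∫ t in (0:ℝ)..T, ∑ k ∈ S₁, ‖g₁ k t‖ ^ 2) := by
  have hN0 : (0:ℝ) < N := by exact_mod_cast hN
  have hM0 : 0 ≤ M := (norm_nonneg _).trans (hM₁ 0 0)
  have cw₁ : ∀ k, Continuous (w₁ k) := fun k => by
    rw [show w₁ k = _ from funext (hw₁ k)]
    exact continuous_const.add
      (intervalIntegral.continuous_primitive (fun a b => bs_ii (hg₁ k) M (hM₁ k) a b) 0)
  have cw₂ : ∀ k, Continuous (w₂ k) := fun k => by
    rw [show w₂ k = _ from funext (hw₂ k)]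
    exact continuous_const.add
      (intervalIntegral.continuous_primitive (fun a b => bs_ii (hg₂ k) M (hM₂ k) a b) 0)
  have iH₁ : IntervalIntegrable (fun t => ∑ k ∈ S₁, ‖g₁ k t‖ ^ 2) volume 0 T := by
    rw [intervalIntegrable_iff, IntegrableOn, uIoc]
    refine integrable_finsetSum _ fun k hk => ?_
    exact bs_bdd_int ((hg₁ k).norm.pow_const 2).aestronglyMeasurable (M ^ 2) (fun z => by
      rw [norm_pow, norm_norm]; exact pow_le_pow_left₀ (norm_nonneg _) (hM₁ k _) 2)
  have iE₁ : IntervalIntegrable (fun t => ∑ k ∈ S₁, ‖w₁ k t‖ ^ 2) volume 0 T :=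
    Continuous.intervalIntegrable (by fun_prop) _ _
  have E₁0 : ∀ t, 0 ≤ ∑ k ∈ S₁, ‖w₁ k t‖ ^ 2 := fun t => Finset.sum_nonneg fun _ _ => by positivity
  have H₁0 : ∀ t, 0 ≤ ∑ k ∈ S₁, ‖g₁ k t‖ ^ 2 := fun t => Finset.sum_nonneg fun _ _ => by positivity
  have IE0 : 0 ≤ ∫ t in (0:ℝ)..T, ∑ k ∈ S₁, ‖w₁ k t‖ ^ 2 :=
    intervalIntegral.integral_nonneg hT.le fun t _ => E₁0 t
  have IH0 : 0 ≤ ∫ t in (0:ℝ)..T, ∑ k ∈ S₁, ‖g₁ k t‖ ^ 2 :=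
    intervalIntegral.integral_nonneg hT.le fun t _ => H₁0 t
  set b : ℤ → ℤ → ℝ → ℂ := fun ξ k t => a k ((ξ:ℝ) - k) * w₁ k t * w₂ (ξ - k) t with hb
  have cb : ∀ ξ k, Continuous (b ξ k) := fun ξ k =>
    (continuous_const.mul (cw₁ k)).mul (cw₂ (ξ - k))
  set Sx : ℤ → Finset ℤ := fun ξ => S₁.filter (fun k => ξ - k ∈ S₂) with hSx
  set G : ℤ → ℝ → ℝ := fun ξ t =>
    ‖∑ k ∈ Sx ξ, b ξ k t * cexp (I * (p k + p ((ξ:ℝ) - k) : ℝ) * t)‖ ^ 2 with hG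
  have iG : ∀ ξ, IntervalIntegrable (G ξ) volume 0 T := fun ξ =>
    Continuous.intervalIntegrable (by simp only [hG]; fun_prop) _ _
  set Lo := Ξ.filter (fun ξ : ℤ => |(ξ:ℝ)| < 8 * X₀ * K) with hLo
  set Hi := Ξ.filter (fun ξ : ℤ => ¬ |(ξ:ℝ)| < 8 * X₀ * K) with hHi
  have hsplit : ∫ t in (0:ℝ)..T, ∑ ξ ∈ Ξ, G ξ t =
      (∫ t in (0:ℝ)..T, ∑ ξ ∈ Lo, G ξ t) + ∑ ξ ∈ Hi, ∫ t in (0:ℝ)..T, G ξ t := by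
    rw [intervalIntegral.integral_finsetSum (fun ξ _ => iG ξ),
      intervalIntegral.integral_finsetSum (fun ξ _ => iG ξ), hLo, hHi,
      Finset.sum_filter_add_sum_filter_not]
  -- low frequencies
  have hlow : ∫ t in (0:ℝ)..T, ∑ ξ ∈ Lo, G ξ t ≤
      24 * X₀ * K * B ^ 2 * ∫ t in (0:ℝ)..T, ∑ k ∈ S₁, ‖w₁ k t‖ ^ 2 := by
    rw [← intervalIntegral.integral_const_mul]
    refine intervalIntegral.integral_mono_on_of_le_Ioo hT.le
      (Continuous.intervalIntegrable (by simp only [hG]; fun_prop) _ _) (iE₁.const_mul _)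
      fun t ht => ?_
    have h1 : ∀ ξ ∈ Lo, G ξ t ≤ (∑ k ∈ S₁, ‖w₁ k t‖ ^ 2) * B ^ 2 := by
      intro ξ _
      refine (bs_low_pt S₁ S₂ ξ (fun k => a k ((ξ:ℝ) - k))
        (fun k => cexp (I * (p k + p ((ξ:ℝ) - k) : ℝ) * t)) (fun k => w₁ k t) (fun k => w₂ k t)
        (fun k => ha _ _) (fun k => bs_norm_exp _ _)).trans ?_
      exact mul_le_mul_of_nonneg_left (hE t ht) (E₁0 t)
    have h2 : (Lo.card : ℝ) ≤ 16 * X₀ * K + 1 := by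
      refine bs_card 0 (16 * X₀ * K) (by positivity) Lo fun k hk => ?_
      have := (Finset.mem_filter.1 hk).2
      rw [Int.cast_zero, sub_zero, abs_mul, abs_two]
      linarith
    have h3 : (Lo.card : ℝ) ≤ 24 * X₀ * K := by nlinarith
    refine (Finset.sum_le_card_nsmul _ _ _ h1).trans ?_
    rw [nsmul_eq_mul]
    have := mul_le_mul_of_nonneg_right h3 (mul_nonneg (E₁0 t) (sq_nonneg B))
    linarith
  -- high frequencies
  have hhigh : ∑ ξ ∈ Hi, ∫ t in (0:ℝ)..T, G ξ t ≤
      48 * (1 + 32 / c₀) * K * (9 * B ^ 2 * ((∫ t in (0:ℝ)..T, ∑ k ∈ S₁, ‖w₁ k t‖ ^ 2) +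
          ((N:ℝ) ^ 2)⁻¹ * ∫ t in (0:ℝ)..T, ∑ k ∈ S₁, ‖g₁ k t‖ ^ 2)) := by
    by_cases hNX : (N:ℝ) < 2 * X₀
    · have : Hi = ∅ := by
        rw [hHi, Finset.filter_eq_empty_iff]
        intro ξ hξ
        rw [not_not]
        have := hΞ ξ hξ
        nlinarith
      rw [this, Finset.sum_empty]
      positivity
    push Not at hNX
    have hW : ∃ W : ℝ, 0 ≤ W ∧ (∀ k ∈ S₁, ∀ t ∈ Icc 0 T, ‖w₁ k t‖ ≤ W) ∧
        (∀ k ∈ S₂, ∀ t ∈ Icc 0 T, ‖w₂ k t‖ ≤ W) := by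
      have hgen : ∀ (S : Finset ℤ) (w g : ℤ → ℝ → ℂ) (c : ℤ → ℂ), (∀ k t, ‖g k t‖ ≤ M) →
          (∀ k t, w k t = c k + ∫ s in (0:ℝ)..t, g k s) → ∀ k ∈ S, ∀ t ∈ Icc 0 T,
          ‖w k t‖ ≤ ∑ k ∈ S, ‖c k‖ + M * T := by
        intro S w g c hM hw k hk t ht
        rw [hw]
        refine (norm_add_le _ _).trans (add_le_add ?_ ?_)
        · exact Finset.single_le_sum (f := fun k => ‖c k‖) (fun _ _ => norm_nonneg _) hk
        · refine (intervalIntegral.norm_integral_le_of_norm_le_const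
            (C := M) fun s _ => hM k s).trans ?_
          rw [sub_zero, abs_of_nonneg ht.1]
          exact mul_le_mul_of_nonneg_left ht.2 hM0
      have p1 : 0 ≤ ∑ k ∈ S₁, ‖c₁ k‖ + M * T := by positivity
      have p2 : 0 ≤ ∑ k ∈ S₂, ‖c₂ k‖ + M * T := by positivity
      refine ⟨(∑ k ∈ S₁, ‖c₁ k‖ + M * T) + (∑ k ∈ S₂, ‖c₂ k‖ + M * T), by positivity, ?_, ?_⟩
      · intro k hk t ht
        linarith [hgen S₁ w₁ g₁ c₁ hM₁ hw₁ k hk t ht]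
      · intro k hk t ht
        linarith [hgen S₂ w₂ g₂ c₂ hM₂ hw₂ k hk t ht]
    obtain ⟨W, hW0, hW₁, hW₂⟩ := hW
    set g : ℤ → ℤ → ℝ → ℂ := fun ξ k => (Icc 0 T).indicator (fun t =>
      a k ((ξ:ℝ) - k) * (g₁ k t * w₂ (ξ - k) t + w₁ k t * g₂ (ξ - k) t)) with hg
    have mg : ∀ ξ k, Measurable (g ξ k) := fun ξ k => by
      refine Measurable.indicator ?_ measurableSet_Icc
      exact measurable_const.mul (((hg₁ k).mul (cw₂ _).measurable).add
        ((cw₁ k).measurable.mul (hg₂ _)))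
    have hgn : ∀ ξ k t, ‖g ξ k t‖ ≤ ‖g₁ k t‖ * ‖w₂ (ξ - k) t‖ + ‖w₁ k t‖ * ‖g₂ (ξ - k) t‖ := by
      intro ξ k t
      by_cases ht : t ∈ Icc 0 T
      · simp only [hg, indicator_of_mem ht]
        rw [norm_mul]
        refine (mul_le_of_le_one_left (norm_nonneg _) (ha _ _)).trans ?_
        refine (norm_add_le _ _).trans ?_
        rw [norm_mul, norm_mul]
      · simp only [hg, indicator_of_notMem ht, norm_zero]
        positivity
    have hgM : ∀ ξ, ∀ k ∈ Sx ξ, ∀ t, ‖g ξ k t‖ ≤ M * W + W * M := by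
      intro ξ k hk t
      by_cases ht : t ∈ Icc 0 T
      · refine (hgn ξ k t).trans ?_
        have hk' := Finset.mem_filter.1 hk
        exact add_le_add
          (mul_le_mul (hM₁ _ _) (hW₂ _ hk'.2 t ht) (norm_nonneg _) hM0)
          (mul_le_mul (hW₁ _ hk'.1 t ht) (hM₂ _ _) (norm_nonneg _) hW0)
      · simp only [hg, indicator_of_notMem ht, norm_zero]
        positivity
    have hbg : ∀ ξ, ∀ k ∈ Sx ξ, ∀ t ∈ Icc 0 T, ∀ t' ∈ Icc 0 T,
        b ξ k t - b ξ k t' = ∫ s in t'..t, g ξ k s := by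
      intro ξ k _ t ht t' ht'
      have := bs_prod (hg₁ k) (hg₂ (ξ - k)) M M (hM₁ k) (hM₂ _) (c₁ k) (c₂ (ξ - k)) (hw₁ k)
        (hw₂ (ξ - k)) t t'
      simp only [hb, mul_assoc]
      rw [← mul_sub, this, ← intervalIntegral.integral_const_mul]
      refine intervalIntegral.integral_congr fun s hs => ?_
      have hs' : s ∈ Icc 0 T := by
        rw [← uIcc_of_le hT.le] at ht ht' ⊢
        exact uIcc_subset_uIcc ht' ht hs
      simp only [hg, indicator_of_mem hs']
    have ib : ∀ ξ, IntervalIntegrable (fun t => ∑ k ∈ Sx ξ, ‖b ξ k t‖ ^ 2) volume 0 T :=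
      fun ξ => Continuous.intervalIntegrable (by fun_prop) _ _
    have ig : ∀ ξ, IntervalIntegrable (fun t => ∑ k ∈ Sx ξ, ‖g ξ k t‖ ^ 2) volume 0 T := by
      intro ξ
      rw [intervalIntegrable_iff, IntegrableOn, uIoc]
      refine integrable_finsetSum _ fun k hk => ?_
      exact bs_bdd_int ((mg ξ k).norm.pow_const 2).aestronglyMeasurable ((M * W + W * M) ^ 2)
        (fun z => by
          rw [norm_pow, norm_norm]; exact pow_le_pow_left₀ (norm_nonneg _) (hgM ξ k hk _) 2)
    have hone : ∀ ξ ∈ Hi, ∫ t in (0:ℝ)..T, G ξ t ≤ 48 * (1 + 32 / c₀) * K *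
        ∫ t in (0:ℝ)..T, ((∑ k ∈ Sx ξ, ‖b ξ k t‖ ^ 2) +
          (T / N) ^ 2 * ∑ k ∈ Sx ξ, ‖g ξ k t‖ ^ 2) := by
      intro ξ hξ
      have hξ' := (Finset.mem_filter.1 hξ).2
      have hξK : K ≤ |(ξ:ℝ)| := by
        push Not at hξ'
        nlinarith
      have := bs_high hα hc hX hd hodd hgap hNX hK hT hKT hξK (Sx ξ) (by
        intro k hk
        have hk' := Finset.mem_filter.1 hk
        rcases hS with h | h
        · exact Or.inl (h k hk'.1)
        · right
          have := h _ hk'.2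
          push_cast at this
          exact this) (b ξ) (g ξ) (cb ξ) (mg ξ) _ (hgM ξ) (hbg ξ)
      refine this.trans (le_of_eq ?_)
      rw [intervalIntegral.integral_add (ib ξ) ((ig ξ).const_mul _),
        intervalIntegral.integral_const_mul]
      ring
    refine (Finset.sum_le_sum hone).trans ?_
    rw [← Finset.mul_sum]
    refine mul_le_mul_of_nonneg_left ?_ (by positivity)
    rw [← intervalIntegral.integral_finsetSum (fun ξ _ => (ib ξ).add ((ig ξ).const_mul _)),
      ← intervalIntegral.integral_const_mul, ← intervalIntegral.integral_add iE₁ (iH₁.const_mul _),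
      ← intervalIntegral.integral_const_mul]
    have isum : IntervalIntegrable (fun t => ∑ ξ ∈ Hi, ((∑ k ∈ Sx ξ, ‖b ξ k t‖ ^ 2) +
          (T / N) ^ 2 * ∑ k ∈ Sx ξ, ‖g ξ k t‖ ^ 2)) volume 0 T := by
      rw [intervalIntegrable_iff, IntegrableOn]
      refine integrable_finsetSum _ fun ξ _ => ?_
      have := (ib ξ).add ((ig ξ).const_mul ((T / N) ^ 2))
      rw [intervalIntegrable_iff, IntegrableOn] at this
      exact this
    refine intervalIntegral.integral_mono_on_of_le_Ioo hT.le isum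
      ((iE₁.add (iH₁.const_mul _)).const_mul _) fun t ht => ?_
    have hTN : (T / N) ^ 2 ≤ ((N:ℝ) ^ 2)⁻¹ := by
      rw [div_pow, div_eq_mul_inv]
      exact mul_le_of_le_one_left (by positivity) (pow_le_one₀ hT.le hT1.le)
    have hpt : ∀ ξ ∈ Hi, (∑ k ∈ Sx ξ, ‖b ξ k t‖ ^ 2) + (T / N) ^ 2 * ∑ k ∈ Sx ξ, ‖g ξ k t‖ ^ 2 ≤
        (∑ k ∈ Sx ξ, ‖w₁ k t‖ ^ 2 * ‖w₂ (ξ - k) t‖ ^ 2) +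
        2 * ((N:ℝ) ^ 2)⁻¹ * ((∑ k ∈ Sx ξ, ‖g₁ k t‖ ^ 2 * ‖w₂ (ξ - k) t‖ ^ 2) +
          ∑ k ∈ Sx ξ, ‖w₁ k t‖ ^ 2 * ‖g₂ (ξ - k) t‖ ^ 2) := by
      intro ξ _
      refine add_le_add (Finset.sum_le_sum fun k _ => ?_) ?_
      · rw [← mul_pow]
        refine pow_le_pow_left₀ (norm_nonneg _) ?_ 2
        simp only [hb]
        rw [norm_mul, norm_mul, mul_assoc]
        exact mul_le_of_le_one_left (by positivity) (ha _ _)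
      · have h1 : ∑ k ∈ Sx ξ, ‖g ξ k t‖ ^ 2 ≤ 2 * ((∑ k ∈ Sx ξ, ‖g₁ k t‖ ^ 2 * ‖w₂ (ξ - k) t‖ ^ 2) +
          ∑ k ∈ Sx ξ, ‖w₁ k t‖ ^ 2 * ‖g₂ (ξ - k) t‖ ^ 2) := by
          rw [← Finset.sum_add_distrib, Finset.mul_sum]
          refine Finset.sum_le_sum fun k _ => ?_
          refine (pow_le_pow_left₀ (norm_nonneg _) (hgn ξ k t) 2).trans ?_
          nlinarith [sq_nonneg (‖g₁ k t‖ * ‖w₂ (ξ - k) t‖ - ‖w₁ k t‖ * ‖g₂ (ξ - k) t‖)]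
        refine (mul_le_mul hTN h1 (Finset.sum_nonneg fun _ _ => by positivity)
          (by positivity)).trans (le_of_eq (by ring))
    refine (Finset.sum_le_sum hpt).trans ?_
    rw [Finset.sum_add_distrib, ← Finset.mul_sum, Finset.sum_add_distrib]
    have q1 := (bs_conv S₁ S₂ Hi (fun k => ‖w₁ k t‖ ^ 2) (fun k => ‖w₂ k t‖ ^ 2)
      (fun _ => by positivity) (fun _ => by positivity)).trans
      (mul_le_mul_of_nonneg_left (hE t ht) (E₁0 t))
    have q2 := (bs_conv S₁ S₂ Hi (fun k => ‖g₁ k t‖ ^ 2) (fun k => ‖w₂ k t‖ ^ 2)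
      (fun _ => by positivity) (fun _ => by positivity)).trans
      (mul_le_mul_of_nonneg_left (hE t ht) (H₁0 t))
    have q3 := (bs_conv S₁ S₂ Hi (fun k => ‖w₁ k t‖ ^ 2) (fun k => ‖g₂ k t‖ ^ 2)
      (fun _ => by positivity) (fun _ => by positivity)).trans
      (mul_le_mul_of_nonneg_left (hH t ht) (E₁0 t))
    have q4 := add_le_add q1 (mul_le_mul_of_nonneg_left (add_le_add q2 q3)
      (show 0 ≤ 2 * ((N:ℝ) ^ 2)⁻¹ by positivity))
    refine q4.trans ?_
    have e : ((N:ℝ) ^ 2)⁻¹ * (N:ℝ) ^ 2 = 1 := by field_simp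
    have e2 : 0 ≤ ((N:ℝ) ^ 2)⁻¹ * (∑ k ∈ S₁, ‖g₁ k t‖ ^ 2) * B ^ 2 := by
      have := H₁0 t
      positivity
    generalize (∑ k ∈ S₁, ‖g₁ k t‖ ^ 2) = H at *
    generalize (∑ k ∈ S₁, ‖w₁ k t‖ ^ 2) = E at *
    have : 2 * ((N:ℝ) ^ 2)⁻¹ * (H * B ^ 2 + E * (4 * (N:ℝ) ^ 2 * B ^ 2)) =
      2 * (((N:ℝ) ^ 2)⁻¹ * H * B ^ 2) + 8 * E * B ^ 2 * (((N:ℝ) ^ 2)⁻¹ * (N:ℝ) ^ 2) := by ring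
    rw [this, e]
    nlinarith
  have hfin : ∀ x : ℝ, x = ((N:ℝ) ^ 2)⁻¹ * (∫ t in (0:ℝ)..T, ∑ k ∈ S₁, ‖g₁ k t‖ ^ 2) → 0 ≤ x := by
    rintro x rfl; positivity
  have h5 := hfin _ rfl
  change ∫ t in (0:ℝ)..T, ∑ ξ ∈ Ξ, G ξ t ≤ _
  rw [hsplit]
  have h6 : 0 ≤ X₀ * K * B ^ 2 := by positivity
  nlinarith [mul_nonneg h6 h5]

lemma bs_symb {χ : ℝ → ℝ} (hχ : CutoffFun χ) {N : ℝ} (hN : 0 < N) (k : ℝ)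
    (h : lpSymb χ N k ≠ 0) : N / 2 ≤ |k| ∧ |k| ≤ 2 * N := by
  rw [lpSymb, if_neg hN.ne'] at h
  constructor
  · by_contra! hk
    rw [abs_lt] at hk
    apply h
    rw [hχ.eq_one, hχ.eq_one, sub_self]
    · constructor
      · rw [le_div_iff₀ hN]; linarith
      · rw [div_le_iff₀ hN]; linarith
    · constructor
      · rw [le_div_iff₀ hN]; linarith
      · rw [div_le_iff₀ hN]; linarith
  · by_contra! hk
    apply h
    have z : ∀ x : ℝ, 2 < |x| → χ x = 0 := by
      intro x hx
      by_contra hne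
      have := hχ.compact_supp x hne
      exact absurd (abs_le.2 this) (not_le.2 hx)
    rw [z, z, sub_self]
    · rw [abs_div, abs_mul, abs_two, abs_of_pos hN, lt_div_iff₀ hN]; linarith
    · rw [abs_div, abs_of_pos hN, lt_div_iff₀ hN]; linarith

lemma bs_symb_le {χ : ℝ → ℝ} (hχ : CutoffFun χ) {N : ℝ} (hN : 0 < N) (k : ℝ) :
    |lpSymb χ N k| ≤ 1 := by
  rw [lpSymb, if_neg hN.ne', abs_le]
  constructor <;> linarith [hχ.nonneg (k / N), hχ.nonneg (2 * k / N), hχ.le_one (k / N),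
    hχ.le_one (2 * k / N)]

/-- Finite set of integer frequencies carrying the projector at scale `2^n`. -/
def bsFreq (n : ℕ) : Finset ℤ :=
  (Finset.Icc (-(2 * 2 ^ n : ℤ)) (2 * 2 ^ n)).filter (fun k => (2:ℝ) ^ n / 2 ≤ |(k:ℝ)|)

lemma bs_freq_lb {n : ℕ} {k : ℤ} (hk : k ∈ bsFreq n) : (2:ℝ) ^ n / 2 ≤ |(k:ℝ)| :=
  (Finset.mem_filter.1 hk).2

lemma bs_freq_ub {n : ℕ} {k : ℤ} (hk : k ∈ bsFreq n) : |(k:ℝ)| ≤ 2 * (2:ℝ) ^ n := by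
  have := Finset.mem_Icc.1 (Finset.mem_filter.1 hk).1
  rw [abs_le]
  exact ⟨by exact_mod_cast this.1, by exact_mod_cast this.2⟩

lemma bs_PN_zero {χ : ℝ → ℝ} (hχ : CutoffFun χ) {n : ℕ} (u : ℤ → ℂ) {k : ℤ}
    (hk : k ∉ bsFreq n) : PN χ ((2:ℝ) ^ n) u k = 0 := by
  by_contra hne
  apply hk
  have h0 : lpSymb χ ((2:ℝ) ^ n) k ≠ 0 := by
    intro h
    apply hne
    simp [PN, h]
  have := bs_symb hχ (by positivity) _ h0
  refine Finset.mem_filter.2 ⟨Finset.mem_Icc.2 ?_, this.1⟩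
  have h2 := abs_le.1 this.2
  exact ⟨by exact_mod_cast h2.1, by exact_mod_cast h2.2⟩

lemma bs_PN_le {χ : ℝ → ℝ} (hχ : CutoffFun χ) (n : ℕ) (u : ℤ → ℂ) (k : ℤ) :
    ‖PN χ ((2:ℝ) ^ n) u k‖ ≤ ‖u k‖ := by
  rw [PN, norm_mul, Complex.norm_real]
  exact mul_le_of_le_one_left (norm_nonneg _) (bs_symb_le hχ (by positivity) _)

lemma bs_l2sq {χ : ℝ → ℝ} (hχ : CutoffFun χ) (n : ℕ) (u : ℤ → ℂ) :
    l2sq (PN χ ((2:ℝ) ^ n) u) = ∑ k ∈ bsFreq n, ‖PN χ ((2:ℝ) ^ n) u k‖ ^ 2 := by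
  rw [l2sq]
  exact tsum_eq_sum fun k hk => by rw [bs_PN_zero hχ u hk]; simp

lemma bs_Lam {χ : ℝ → ℝ} (hχ : CutoffFun χ) (n₁ n₂ : ℕ) (a : ℝ → ℝ → ℂ) (u v : ℤ → ℂ) (ξ : ℤ) :
    Lam a (PN χ ((2:ℝ) ^ n₁) u) (PN χ ((2:ℝ) ^ n₂) v) ξ =
      ∑ k ∈ (bsFreq n₁).filter (fun k => ξ - k ∈ bsFreq n₂),
        a k ((ξ:ℝ) - k) * PN χ ((2:ℝ) ^ n₁) u k * PN χ ((2:ℝ) ^ n₂) v (ξ - k) := by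
  rw [Lam]
  refine tsum_eq_sum fun k hk => ?_
  rw [Finset.mem_filter, not_and_or] at hk
  rcases hk with hk | hk
  · rw [bs_PN_zero hχ u hk]; simp
  · rw [bs_PN_zero hχ v hk]; simp

lemma bs_l2sq_Lam {χ : ℝ → ℝ} (hχ : CutoffFun χ) (n₁ n₂ : ℕ) (a : ℝ → ℝ → ℂ) (u v : ℤ → ℂ) :
    l2sq (Lam a (PN χ ((2:ℝ) ^ n₁) u) (PN χ ((2:ℝ) ^ n₂) v)) =
      ∑ ξ ∈ Finset.Icc (-(4 * 2 ^ max n₁ n₂ : ℤ)) (4 * 2 ^ max n₁ n₂),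
      ‖∑ k ∈ (bsFreq n₁).filter (fun k => ξ - k ∈ bsFreq n₂),
        a k ((ξ:ℝ) - k) * PN χ ((2:ℝ) ^ n₁) u k * PN χ ((2:ℝ) ^ n₂) v (ξ - k)‖ ^ 2 := by
  rw [l2sq]
  simp only [bs_Lam hχ]
  refine tsum_eq_sum fun ξ hξ => ?_
  rw [Finset.filter_eq_empty_iff.2, Finset.sum_empty]
  · simp
  intro k hk hk2
  apply hξ
  have h1 := bs_freq_ub hk
  have h2 := bs_freq_ub hk2
  have h3 : (2:ℝ) ^ n₁ ≤ 2 ^ max n₁ n₂ := pow_le_pow_right₀ (by norm_num) (le_max_left _ _)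
  have h4 : (2:ℝ) ^ n₂ ≤ 2 ^ max n₁ n₂ := pow_le_pow_right₀ (by norm_num) (le_max_right _ _)
  push_cast at h2
  have h5 : |(ξ:ℝ)| ≤ 4 * 2 ^ max n₁ n₂ := by
    have := abs_add_le (k:ℝ) ((ξ:ℝ) - k)
    rw [add_sub_cancel] at this
    linarith
  have h6 := abs_le.1 h5
  exact Finset.mem_Icc.2 ⟨by exact_mod_cast h6.1, by exact_mod_cast h6.2⟩

lemma bs_duh {χ : ℝ → ℝ} (hχ : CutoffFun χ) {p : ℝ → ℝ} {T : ℝ}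
    {U F : ℝ → ℤ → ℂ} (hF : MemLinfL2 T F) (hU : Solves p T U F) (n : ℕ) :
    ∃ (w g : ℤ → ℝ → ℂ) (c : ℤ → ℂ) (M : ℝ), 0 ≤ M ∧ (∀ k, Measurable (g k)) ∧
      (∀ k t, ‖g k t‖ ≤ M) ∧ (∀ k t, w k t = c k + ∫ s in (0:ℝ)..t, g k s) ∧
      (∀ k, Continuous (w k)) ∧
      (∀ k, ∀ t ∈ Icc 0 T, PN χ ((2:ℝ) ^ n) (U t) k = cexp (I * (p k) * t) * w k t) ∧
      (∀ k, ∀ t ∈ Ioo 0 T, ‖g k t‖ = |(k:ℝ)| * ‖PN χ ((2:ℝ) ^ n) (F t) k‖) ∧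
      (∀ k, ∀ t ∈ Ioo 0 T, ‖PN χ ((2:ℝ) ^ n) (F t) k‖ ≤ M) := by
  obtain ⟨hs, hm, M', hM'⟩ := hF
  have hFb : ∀ k, ∀ t ∈ Ioo 0 T, ‖PN χ ((2:ℝ) ^ n) (F t) k‖ ≤ √M' := by
    intro k t ht
    refine (bs_PN_le hχ n _ k).trans (Real.le_sqrt_of_sq_le (le_trans ?_ (hM' t ht)))
    exact (hs t ht).le_tsum k fun j _ => by positivity
  have hM0 := Real.sqrt_nonneg M'
  have h2n : (1:ℝ) ≤ 2 ^ n := one_le_pow₀ (by norm_num)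
  set g : ℤ → ℝ → ℂ := fun k => (Ioo 0 T).indicator (fun s =>
    -(cexp (-(I * (p k) * s)) * (I * (k:ℂ)) * PN χ ((2:ℝ) ^ n) (F s) k)) with hg
  have gn : ∀ k, ∀ t ∈ Ioo 0 T, ‖g k t‖ = |(k:ℝ)| * ‖PN χ ((2:ℝ) ^ n) (F t) k‖ := by
    intro k t ht
    simp only [hg, indicator_of_mem ht]
    have e1 : cexp (-(I * (p k) * t)) = cexp (I * (-(p k) : ℝ) * t) := by
      congr 1; push_cast; ring
    rw [norm_neg, norm_mul, norm_mul, e1, bs_norm_exp, one_mul, norm_mul, norm_I, one_mul,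
      Complex.norm_intCast]
  have gM : ∀ k t, ‖g k t‖ ≤ 2 * 2 ^ n * √M' := by
    intro k t
    by_cases ht : t ∈ Ioo 0 T
    · rw [gn k t ht]
      by_cases hk : k ∈ bsFreq n
      · exact mul_le_mul (bs_freq_ub hk) (hFb k t ht) (norm_nonneg _) (by positivity)
      · rw [bs_PN_zero hχ _ hk, norm_zero, mul_zero]; positivity
    · simp only [hg, indicator_of_notMem ht, norm_zero]; positivity
  have gm : ∀ k, Measurable (g k) := by
    intro k
    refine Measurable.indicator ?_ measurableSet_Ioo
    have h1 : Measurable fun s => PN χ ((2:ℝ) ^ n) (F s) k := (hm k).const_mul _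
    have h2 : Continuous fun s : ℝ => cexp (-(I * (p k) * s)) * (I * (k:ℂ)) := by fun_prop
    exact (h2.measurable.mul h1).neg
  refine ⟨fun k t => PN χ ((2:ℝ) ^ n) (U 0) k + ∫ s in (0:ℝ)..t, g k s, g,
    PN χ ((2:ℝ) ^ n) (U 0), 2 * 2 ^ n * √M', by positivity, gm, gM, fun _ _ => rfl, ?_, ?_, gn, ?_⟩
  · intro k
    exact continuous_const.add
      (intervalIntegral.continuous_primitive (fun a b => bs_ii (gm k) _ (gM k) a b) 0)
  · intro k t ht
    have h := hU k t ht
    have e : ∫ s in (0:ℝ)..t, g k s = ∫ s in (0:ℝ)..t,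
        -(cexp (-(I * (p k) * s)) * (I * (k:ℂ)) * PN χ ((2:ℝ) ^ n) (F s) k) := by
      rw [intervalIntegral.integral_of_le ht.1, intervalIntegral.integral_of_le ht.1,
        integral_Ioc_eq_integral_Ioo, integral_Ioc_eq_integral_Ioo]
      refine setIntegral_congr_fun measurableSet_Ioo fun s hs' => ?_
      simp only [hg]
      rw [indicator_of_mem (show s ∈ Ioo 0 T from ⟨hs'.1, hs'.2.trans_le ht.2⟩)]
    beta_reduce
    rw [PN, h, e, mul_add, mul_sub, sub_eq_add_neg]
    congr 1
    · simp only [PN]; ring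
    · rw [← intervalIntegral.integral_const_mul, ← intervalIntegral.integral_const_mul,
        ← intervalIntegral.integral_neg]
      refine intervalIntegral.integral_congr fun s _ => ?_
      have : cexp (I * (p k) * (t - s)) = cexp (I * (p k) * t) * cexp (-(I * (p k) * s)) := by
        rw [← Complex.exp_add]; congr 1; ring
      simp only [PN, this]
      ring
  · intro k t ht
    refine (hFb k t ht).trans ?_
    nlinarith

set_option maxHeartbeats 2000000

/-- Improved bilinear Strichartz estimate I:
if `u_j ∈ C([0,T];L²(𝕋))` solve `∂_t u_j + L_{α+1}u_j + ∂_x f_j = 0` with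
`f_j ∈ L^∞(]0,T[;L²(𝕋))`, then for dyadic `N₁,N₂ ≥ 1`,
`‖Λ_a(P_{N₁}u₁,P_{N₂}u₂)‖_{L²(]0,T[×𝕋)} ≤ C T^{-1/4}(N₁∨N₂)^{1/2-α/4} ⋯`. -/
theorem improved_bilinear_strichartz_I
    (α ξ₀ c₀ C₀ : ℝ) (hα : α ∈ Set.Icc (1:ℝ) 2)
    (p : ℝ → ℝ) (hp : Hyp1 α ξ₀ c₀ C₀ p)
    (χ : ℝ → ℝ) (hχ : CutoffFun χ) :
    ∃ C : ℝ, 0 < C ∧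
      ∀ (T : ℝ), 0 < T → T < 1 →
      ∀ (a : ℝ → ℝ → ℂ), (∀ x y : ℝ, ‖a x y‖ ≤ 1) →
      ∀ (U₁ U₂ F₁ F₂ : ℝ → ℤ → ℂ),
        ContL2On T U₁ → ContL2On T U₂ →
        MemLinfL2 T F₁ → MemLinfL2 T F₂ →
        Solves p T U₁ F₁ → Solves p T U₂ F₂ →
        ∀ (n₁ n₂ : ℕ),
          L2normOn (Set.Ioo 0 T)
              (fun t => Lam a (PN χ ((2:ℝ) ^ n₁) (U₁ t)) (PN χ ((2:ℝ) ^ n₂) (U₂ t))) ≤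
            C * T ^ (-(1:ℝ)/4) *
              (max ((2:ℝ) ^ n₁) ((2:ℝ) ^ n₂)) ^ ((1:ℝ)/2 - α/4) *
              (L2normOn (Set.Ioo 0 T) (fun t => PN χ ((2:ℝ) ^ n₁) (U₁ t)) +
                L2normOn (Set.Ioo 0 T) (fun t => PN χ ((2:ℝ) ^ n₁) (F₁ t))) *
              (LinfL2 T (fun t => PN χ ((2:ℝ) ^ n₂) (U₂ t)) +
                LinfL2 T (fun t => PN χ ((2:ℝ) ^ n₂) (F₂ t))) := by
  obtain ⟨X₀, hX, hgap⟩ := bs_deriv_gap hα hp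
  have hc := hp.c_pos
  have hd : Differentiable ℝ p := hp.smooth1.differentiable (by norm_num)
  set Cc : ℝ := 24 * X₀ + 432 * (1 + 32 / c₀) with hCc
  have hCc0 : 0 < Cc := by positivity
  refine ⟨2 * √Cc, by positivity, ?_⟩
  intro T hT hT1 a ha U₁ U₂ F₁ F₂ _ _ hF₁ hF₂ hU₁ hU₂ n₁ n₂
  obtain ⟨w₁, g₁, c₁, M₁, hM₁0, mg₁, hM₁, hw₁, cw₁, hPU₁, hgF₁, hFM₁⟩ := bs_duh hχ hF₁ hU₁ n₁
  obtain ⟨w₂, g₂, c₂, M₂, hM₂0, mg₂, hM₂, hw₂, cw₂, hPU₂, hgF₂, hFM₂⟩ := bs_duh hχ hF₂ hU₂ n₂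
  -- scales
  set N : ℕ := 2 ^ max n₁ n₂ with hNdef
  have hN1 : 1 ≤ N := Nat.one_le_two_pow
  have hNR : (N:ℝ) = 2 ^ max n₁ n₂ := by rw [hNdef]; push_cast; rfl
  have hN1R : (1:ℝ) ≤ N := by exact_mod_cast hN1
  have hle₁ : (2:ℝ) ^ n₁ ≤ N := by
    rw [hNR]; exact pow_le_pow_right₀ (by norm_num) (le_max_left _ _)
  have hle₂ : (2:ℝ) ^ n₂ ≤ N := by
    rw [hNR]; exact pow_le_pow_right₀ (by norm_num) (le_max_right _ _)
  have hmax : max ((2:ℝ) ^ n₁) ((2:ℝ) ^ n₂) = N := by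
    rw [hNR]
    rcases le_total n₁ n₂ with h | h
    · rw [max_eq_right h, max_eq_right (pow_le_pow_right₀ (by norm_num) h)]
    · rw [max_eq_left h, max_eq_left (pow_le_pow_right₀ (by norm_num) h)]
  rw [hmax]
  set κ : ℝ := T ^ (-(1:ℝ)/4) * (N:ℝ) ^ ((1:ℝ)/2 - α/4) with hκ
  have hκ1 : 1 ≤ κ := by
    rw [hκ]
    refine one_le_mul_of_one_le_of_one_le ?_ ?_
    · exact Real.one_le_rpow_of_pos_of_le_one_of_nonpos hT hT1.le (by norm_num)
    · exact Real.one_le_rpow hN1R (by linarith [hα.2])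
  have hKT : (κ ^ 2) ^ 2 * T = (N:ℝ) ^ (2 - α) := by
    have hN0 : (0:ℝ) ≤ N := by linarith
    rw [← pow_mul, hκ, mul_pow, ← Real.rpow_natCast (T ^ (-(1:ℝ)/4)),
      ← Real.rpow_natCast ((N:ℝ) ^ ((1:ℝ)/2 - α/4)), ← Real.rpow_mul hT.le, ← Real.rpow_mul hN0]
    have e1 : -(1:ℝ)/4 * ((2 * 2 : ℕ) : ℝ) = -1 := by push_cast; norm_num
    have e2 : ((1:ℝ)/2 - α/4) * ((2 * 2 : ℕ) : ℝ) = 2 - α := by push_cast; ring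
    rw [e1, e2, Real.rpow_neg_one]
    field_simp
  have hnorm : ∀ (q t : ℝ) (z : ℂ), ‖cexp (I * q * t) * z‖ = ‖z‖ := by
    intro q t z
    rw [norm_mul, bs_norm_exp, one_mul]
  have hsqU₁ : ∀ t ∈ Icc 0 T, l2sq (PN χ ((2:ℝ) ^ n₁) (U₁ t)) = ∑ k ∈ bsFreq n₁, ‖w₁ k t‖ ^ 2 := by
    intro t ht
    rw [bs_l2sq hχ]
    exact Finset.sum_congr rfl fun k _ => by rw [hPU₁ k t ht, hnorm]
  have hsqU₂ : ∀ t ∈ Icc 0 T, l2sq (PN χ ((2:ℝ) ^ n₂) (U₂ t)) = ∑ k ∈ bsFreq n₂, ‖w₂ k t‖ ^ 2 := by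
    intro t ht
    rw [bs_l2sq hχ]
    exact Finset.sum_congr rfl fun k _ => by rw [hPU₂ k t ht, hnorm]
  have hgsq : ∀ (n : ℕ) (g : ℤ → ℝ → ℂ) (F : ℝ → ℤ → ℂ), (2:ℝ) ^ n ≤ N →
      (∀ k, ∀ t ∈ Ioo 0 T, ‖g k t‖ = |(k:ℝ)| * ‖PN χ ((2:ℝ) ^ n) (F t) k‖) → ∀ t ∈ Ioo 0 T,
      ∑ k ∈ bsFreq n, ‖g k t‖ ^ 2 ≤ 4 * (N:ℝ) ^ 2 * l2sq (PN χ ((2:ℝ) ^ n) (F t)) := by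
    intro n g F hn hg t ht
    rw [bs_l2sq hχ, Finset.mul_sum]
    refine Finset.sum_le_sum fun k hk => ?_
    rw [hg k t ht, mul_pow]
    refine mul_le_mul_of_nonneg_right ?_ (by positivity)
    have h1 : |(k:ℝ)| ≤ 2 * N := (bs_freq_ub hk).trans (by linarith)
    calc |(k:ℝ)| ^ 2 ≤ (2 * N) ^ 2 := pow_le_pow_left₀ (abs_nonneg _) h1 2
      _ = _ := by ring
  have l2nn : ∀ v : ℤ → ℂ, 0 ≤ l2sq v := fun v => tsum_nonneg fun _ => by positivity
  -- sup norms
  set b₁ := LinfL2 T (fun t => PN χ ((2:ℝ) ^ n₂) (U₂ t)) with hb₁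
  set b₂ := LinfL2 T (fun t => PN χ ((2:ℝ) ^ n₂) (F₂ t)) with hb₂
  have hb₁0 : 0 ≤ b₁ := Real.iSup_nonneg fun t => Real.rpow_nonneg (l2nn _) _
  have hb₂0 : 0 ≤ b₂ := Real.iSup_nonneg fun t => Real.rpow_nonneg (l2nn _) _
  have hsup : ∀ (V : ℝ → ℤ → ℂ) (Q : ℝ), (∀ t ∈ Ioo 0 T, l2sq (V t) ≤ Q) →
      ∀ t ∈ Ioo 0 T, l2sq (V t) ≤ (LinfL2 T V) ^ 2 := by
    intro V Q hQ t ht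
    have h1 : (l2sq (V t)) ^ ((1:ℝ)/2) ≤ LinfL2 T V := by
      refine le_ciSup (f := fun t : Set.Ioo (0:ℝ) T => (l2sq (V t)) ^ ((1:ℝ)/2)) ?_ ⟨t, ht⟩
      refine ⟨Q ^ ((1:ℝ)/2), ?_⟩
      rintro _ ⟨s, rfl⟩
      exact Real.rpow_le_rpow (l2nn _) (hQ s s.2) (by norm_num)
    rw [← Real.sqrt_eq_rpow] at h1
    exact (Real.sqrt_le_left ((Real.sqrt_nonneg _).trans h1)).1 h1
  have hE : ∀ t ∈ Ioo 0 T, ∑ k ∈ bsFreq n₂, ‖w₂ k t‖ ^ 2 ≤ (b₁ + b₂) ^ 2 := by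
    intro t ht
    obtain ⟨Q, hQ⟩ := (isCompact_Icc (a := (0:ℝ)) (b := T)).exists_bound_of_continuousOn
      (f := fun t => ∑ k ∈ bsFreq n₂, ‖w₂ k t‖ ^ 2) (by fun_prop)
    rw [← hsqU₂ t (Ioo_subset_Icc_self ht)]
    refine (hsup (fun t => PN χ ((2:ℝ) ^ n₂) (U₂ t)) Q ?_ t ht).trans
      (pow_le_pow_left₀ hb₁0 (by linarith) 2)
    intro s hs
    have := hQ s (Ioo_subset_Icc_self hs)
    rw [← hsqU₂ s (Ioo_subset_Icc_self hs), Real.norm_eq_abs] at this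
    exact (le_abs_self _).trans this
  have hH : ∀ t ∈ Ioo 0 T, ∑ k ∈ bsFreq n₂, ‖g₂ k t‖ ^ 2 ≤ 4 * (N:ℝ) ^ 2 * (b₁ + b₂) ^ 2 := by
    intro t ht
    refine (hgsq n₂ g₂ F₂ hle₂ hgF₂ t ht).trans ?_
    refine mul_le_mul_of_nonneg_left ?_ (by positivity)
    refine (hsup (fun t => PN χ ((2:ℝ) ^ n₂) (F₂ t)) (∑ k ∈ bsFreq n₂, M₂ ^ 2) ?_ t ht).trans
      (pow_le_pow_left₀ hb₂0 (by linarith) 2)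
    intro s hs
    rw [bs_l2sq hχ]
    exact Finset.sum_le_sum fun k _ => pow_le_pow_left₀ (norm_nonneg _) (hFM₂ k s hs) 2
  -- the core estimate
  have hS : (∀ k ∈ bsFreq n₁, (N:ℝ) / 2 ≤ |(k:ℝ)|) ∨ (∀ k ∈ bsFreq n₂, (N:ℝ) / 2 ≤ |(k:ℝ)|) := by
    rw [hNR]
    rcases le_total n₁ n₂ with h | h
    · right; rw [max_eq_right h]; exact fun k hk => bs_freq_lb hk
    · left; rw [max_eq_left h]; exact fun k hk => bs_freq_lb hk
  have hcore := bs_core hα hc hX hd hp.odd hgap hN1 (one_le_pow₀ hκ1 : 1 ≤ κ ^ 2) hT hT1 hKT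
    (bsFreq n₁) (bsFreq n₂) (Finset.Icc (-(4 * 2 ^ max n₁ n₂ : ℤ)) (4 * 2 ^ max n₁ n₂)) hS (by
      intro ξ hξ
      have := Finset.mem_Icc.1 hξ
      rw [hNR, abs_le]
      exact ⟨by exact_mod_cast this.1, by exact_mod_cast this.2⟩) a ha w₁ w₂ g₁ g₂ c₁ c₂
    (M₁ + M₂) mg₁ mg₂ (fun k t => (hM₁ k t).trans (by linarith))
    (fun k t => (hM₂ k t).trans (by linarith)) hw₁ hw₂ (b₁ + b₂) hE hH
  -- identification of the three integrals
  have hI : ∀ f : ℝ → ℝ, ∫ t in (0:ℝ)..T, f t = ∫ t in Ioo 0 T, f t := fun f => by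
    rw [intervalIntegral.integral_of_le hT.le, integral_Ioc_eq_integral_Ioo]
  rw [hI, hI, hI] at hcore
  have eL : ∫ t in Ioo 0 T, l2sq (Lam a (PN χ ((2:ℝ) ^ n₁) (U₁ t)) (PN χ ((2:ℝ) ^ n₂) (U₂ t))) =
      ∫ t in Ioo 0 T, ∑ ξ ∈ Finset.Icc (-(4 * 2 ^ max n₁ n₂ : ℤ)) (4 * 2 ^ max n₁ n₂),
        ‖∑ k ∈ (bsFreq n₁).filter (fun k => ξ - k ∈ bsFreq n₂),
        a k ((ξ:ℝ) - k) * w₁ k t * w₂ (ξ - k) t * cexp (I * (p k + p ((ξ:ℝ) - k) : ℝ) * t)‖ ^ 2 := by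
    refine setIntegral_congr_fun measurableSet_Ioo fun t ht => ?_
    have ht' := Ioo_subset_Icc_self ht
    simp only [bs_l2sq_Lam hχ]
    refine Finset.sum_congr rfl fun ξ _ => ?_
    congr 2
    refine Finset.sum_congr rfl fun k _ => ?_
    rw [hPU₁ k t ht', hPU₂ (ξ - k) t ht']
    have : cexp (I * (p k + p ((ξ:ℝ) - k) : ℝ) * t) =
        cexp (I * (p k) * t) * cexp (I * (p ((ξ - k : ℤ) : ℝ)) * t) := by
      rw [← Complex.exp_add]; congr 1; push_cast; ring
    rw [this]
    ring
  have eX : ∫ t in Ioo 0 T, l2sq (PN χ ((2:ℝ) ^ n₁) (U₁ t)) =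
      ∫ t in Ioo 0 T, ∑ k ∈ bsFreq n₁, ‖w₁ k t‖ ^ 2 :=
    setIntegral_congr_fun measurableSet_Ioo fun t ht => hsqU₁ t (Ioo_subset_Icc_self ht)
  have eY : ((N:ℝ) ^ 2)⁻¹ * ∫ t in Ioo 0 T, ∑ k ∈ bsFreq n₁, ‖g₁ k t‖ ^ 2 ≤
      4 * ∫ t in Ioo 0 T, l2sq (PN χ ((2:ℝ) ^ n₁) (F₁ t)) := by
    rw [← integral_const_mul, ← integral_const_mul]
    have hYi : IntegrableOn (fun t => l2sq (PN χ ((2:ℝ) ^ n₁) (F₁ t))) (Ioo 0 T) := by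
      simp only [bs_l2sq hχ]
      refine integrable_finsetSum _ fun k _ => ?_
      have hmeas : Measurable fun t => PN χ ((2:ℝ) ^ n₁) (F₁ t) k := (hF₁.2.1 k).const_mul _
      refine Integrable.of_bound (hmeas.norm.pow_const 2).aestronglyMeasurable (M₁ ^ 2) ?_
      refine (ae_restrict_iff' measurableSet_Ioo).2 (Eventually.of_forall fun t ht => ?_)
      rw [norm_pow, norm_norm]
      exact pow_le_pow_left₀ (norm_nonneg _) (hFM₁ k t ht) 2
    have hHi : IntegrableOn (fun t => ∑ k ∈ bsFreq n₁, ‖g₁ k t‖ ^ 2) (Ioo 0 T) := by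
      refine integrable_finsetSum _ fun k _ => ?_
      exact bs_bdd_int ((mg₁ k).norm.pow_const 2).aestronglyMeasurable (M₁ ^ 2) (fun z => by
        rw [norm_pow, norm_norm]; exact pow_le_pow_left₀ (norm_nonneg _) (hM₁ k _) 2)
    refine setIntegral_mono_on (hHi.const_mul _) (hYi.const_mul _) measurableSet_Ioo
      fun t ht => ?_
    have h1 := mul_le_mul_of_nonneg_left (hgsq n₁ g₁ F₁ hle₁ hgF₁ t ht)
      (show 0 ≤ ((N:ℝ) ^ 2)⁻¹ by positivity)
    refine h1.trans (le_of_eq ?_)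
    have : (N:ℝ) ≠ 0 := by linarith
    field_simp
  rw [← eL, ← eX] at hcore
  simp only [L2normOn, ← Real.sqrt_eq_rpow]
  have hX0 : 0 ≤ ∫ t in Ioo 0 T, l2sq (PN χ ((2:ℝ) ^ n₁) (U₁ t)) := integral_nonneg fun t => l2nn _
  have hY0 : 0 ≤ ∫ t in Ioo 0 T, l2sq (PN χ ((2:ℝ) ^ n₁) (F₁ t)) := integral_nonneg fun t => l2nn _
  generalize (∫ t in Ioo 0 T, l2sq (PN χ ((2:ℝ) ^ n₁) (U₁ t))) = X at *
  generalize (∫ t in Ioo 0 T, l2sq (PN χ ((2:ℝ) ^ n₁) (F₁ t))) = Y at *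
  rw [show 2 * √Cc * T ^ (-(1:ℝ)/4) * (N:ℝ) ^ ((1:ℝ)/2 - α/4) * (√X + √Y) * (b₁ + b₂) =
    2 * √Cc * κ * (√X + √Y) * (b₁ + b₂) by rw [hκ]; ring]
  refine Real.sqrt_le_iff.2 ⟨by positivity, hcore.trans ?_⟩
  have e1 : (2 * √Cc * κ * (√X + √Y) * (b₁ + b₂)) ^ 2 =
      Cc * κ ^ 2 * (b₁ + b₂) ^ 2 * (4 * (√X + √Y) ^ 2) := by
    rw [mul_pow, mul_pow, mul_pow, mul_pow, Real.sq_sqrt hCc0.le]; ring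
  rw [e1]
  refine mul_le_mul_of_nonneg_left ?_ (by positivity)
  have e2 := Real.sq_sqrt hX0
  have e3 := Real.sq_sqrt hY0
  have e4 := mul_nonneg (Real.sqrt_nonneg X) (Real.sqrt_nonneg Y)
  nlinarith

end
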